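/- arXiv:1402.3621 — 2 statements merged into one kernel-verified Lean document; each statement's English description precedes it below -/
import Mathlib

section
/- For every α > 0 and every ε > 0 there exists a constant C = C(α, ε) > 0 such that for every positive integer m which is a sum of two squares, Σ_{d} 1/√d ≤ C · N^ε, where N = #{μ ∈ ℤ² : μ₁² + μ₂² = m} and the sum runs over all positive divisors d of m such that d < N^α and d is a sum of two integer squares. -/
open MeasureTheory ProbabilityTheory Real

noncomputable section

/-- The set of lattice points on the circle of radius `√m`:
`E = {μ ∈ ℤ² : μ₁² + μ₂² = m}` (all solutions satisfy `|μᵢ| ≤ m`). -/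
def latticeSet (m : ℕ) : Finset (ℤ × ℤ) :=
  (Finset.Icc (-(m : ℤ)) (m : ℤ) ×ˢ Finset.Icc (-(m : ℤ)) (m : ℤ)).filter
    (fun μ => μ.1 ^ 2 + μ.2 ^ 2 = (m : ℤ))

/-- `N = #E`, the number of lattice points on the circle of radius `√m`. -/
def latN (m : ℕ) : ℕ := (latticeSet m).card

theorem mem_latticeSet {m : ℕ} {x y : ℤ} :
    (x, y) ∈ latticeSet m ↔ (⟨x, y⟩ : GaussianInt).norm = m := by
  simp only [latticeSet, Finset.mem_filter, Finset.mem_product, Finset.mem_Icc, Zsqrtd.norm_def]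
  constructor
  · rintro ⟨-, h⟩
    linarith
  · intro h
    refine ⟨⟨⟨?_, ?_⟩, ?_, ?_⟩, by linarith⟩ <;>
      nlinarith [Int.le_self_sq x, Int.le_self_sq y, Int.le_self_sq (-x), Int.le_self_sq (-y)]

theorem latN_pos {m : ℕ} (h : ∃ x y : ℕ, m = x ^ 2 + y ^ 2) : 0 < latN m := by
  obtain ⟨x, y, rfl⟩ := h
  refine Finset.card_pos.mpr ⟨(x, y), mem_latticeSet.mpr ?_⟩
  simp only [Zsqrtd.norm_def]
  push_cast
  ring

/-- A prime `p ≡ 1 mod 4` is the norm of a Gaussian integer coprime to its conjugate. -/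
theorem exists_gaussianInt_norm_eq_isCoprime_star {p : ℕ} (hp : p.Prime) (h4 : p % 4 = 1) :
    ∃ z : GaussianInt, z.norm = p ∧ IsCoprime z (star z) := by
  have : Fact p.Prime := ⟨hp⟩
  obtain ⟨a, b, hab⟩ := Nat.Prime.sq_add_sq (p := p) (by omega)
  have hnorm : (⟨a, b⟩ : GaussianInt).norm = p := by
    rw [Zsqrtd.norm_def, ← hab]
    push_cast
    ring
  refine ⟨⟨a, b⟩, hnorm, ?_⟩
  have h2a : ¬ p ∣ 2 * a := by
    intro h
    rcases hp.dvd_mul.mp h with h | h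
    · have := Nat.le_of_dvd two_pos h
      have := hp.two_le
      omega
    · rcases Nat.eq_zero_or_pos a with rfl | ha
      · simp only [ne_eq, OfNat.ofNat_ne_zero, not_false_eq_true, zero_pow, zero_add] at hab
        exact hp.prime.irreducible.not_isSquare ⟨b, by rw [← hab, sq]⟩
      · have := Nat.le_of_dvd ha h
        have := hp.two_le
        nlinarith
  obtain ⟨u, v, huv⟩ := ((hp.coprime_iff_not_dvd.mpr h2a).isCoprime : IsCoprime (p : ℤ) (2 * a : ℕ))
  have hp' : ((p : ℤ) : GaussianInt) = ⟨a, b⟩ * star ⟨a, b⟩ := by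
    rw [← hnorm, Zsqrtd.norm_eq_mul_conj]
  have ha' : (((2 * a : ℕ) : ℤ) : GaussianInt) = ⟨a, b⟩ + star ⟨a, b⟩ := by
    ext <;> simp [two_mul]
  have huv' := congrArg (Int.cast : ℤ → GaussianInt) huv
  rw [Int.cast_add, Int.cast_mul, Int.cast_mul, hp', ha', Int.cast_one] at huv'
  exact ⟨u * star ⟨a, b⟩ + v, v, by linear_combination huv'⟩

theorem two_mul_latN_le {p k m : ℕ} (hp : p.Prime) (h4 : p % 4 = 1) (hk : k ≠ 0)
    (hpm : ¬ p ∣ m) : 2 * latN m ≤ latN (p ^ k * m) := by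
  obtain ⟨z, hz, hcop⟩ := exists_gaussianInt_norm_eq_isCoprime_star hp h4
  let f (w : GaussianInt) (x : ℤ × ℤ) : ℤ × ℤ := ((w * ⟨x.1, x.2⟩).re, (w * ⟨x.1, x.2⟩).im)
  have hf_inj (w : GaussianInt) (hw : w.norm = (p : ℤ) ^ k) : Function.Injective (f w) := by
    intro x y hxy
    have h0 : w ≠ 0 := by
      rintro rfl
      simp [hk, hp.ne_zero, eq_comm] at hw
    have : (⟨x.1, x.2⟩ : GaussianInt) = ⟨y.1, y.2⟩ :=
      mul_left_cancel₀ h0 (Zsqrtd.ext (congrArg Prod.fst hxy) (congrArg Prod.snd hxy))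
    exact Prod.ext (congrArg Zsqrtd.re this) (congrArg Zsqrtd.im this)
  have hf_mem (w : GaussianInt) (hw : w.norm = (p : ℤ) ^ k) :
      (latticeSet m).image (f w) ⊆ latticeSet (p ^ k * m) := by
    intro y hy
    obtain ⟨x, hx, rfl⟩ := Finset.mem_image.mp hy
    rw [mem_latticeSet]
    change (w * ⟨x.1, x.2⟩).norm = _
    rw [Zsqrtd.norm_mul, hw, mem_latticeSet.mp hx]
    push_cast
    rfl
  have hz1 : (z ^ k).norm = (p : ℤ) ^ k := by
    rw [← hz]
    exact map_pow Zsqrtd.normMonoidHom z k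
  have hz2 : (star z ^ k).norm = (p : ℤ) ^ k := by
    rw [← star_pow, Zsqrtd.norm_conj, hz1]
  have hdisj : Disjoint ((latticeSet m).image (f (z ^ k)))
      ((latticeSet m).image (f (star z ^ k))) := by
    rw [Finset.disjoint_left]
    intro t h1 h2
    obtain ⟨x, hx, rfl⟩ := Finset.mem_image.mp h1
    obtain ⟨y, hy, hxy⟩ := Finset.mem_image.mp h2
    have heq : star z ^ k * ⟨y.1, y.2⟩ = z ^ k * (⟨x.1, x.2⟩ : GaussianInt) :=
      Zsqrtd.ext (congrArg Prod.fst hxy) (congrArg Prod.snd hxy)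
    have hdvd : z ^ k ∣ (⟨y.1, y.2⟩ : GaussianInt) :=
      (hcop.pow (m := k) (n := k)).dvd_of_dvd_mul_left (heq ▸ dvd_mul_right _ _)
    have hdvd' := map_dvd Zsqrtd.normMonoidHom hdvd
    change (z ^ k).norm ∣ (⟨y.1, y.2⟩ : GaussianInt).norm at hdvd'
    rw [hz1, mem_latticeSet.mp hy] at hdvd'
    exact hpm ((dvd_pow_self p hk).trans (by exact_mod_cast hdvd'))
  calc 2 * latN m
      = ((latticeSet m).image (f (z ^ k)) ∪ (latticeSet m).image (f (star z ^ k))).card := by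
        rw [Finset.card_union_of_disjoint hdisj, Finset.card_image_of_injective _ (hf_inj _ hz1),
          Finset.card_image_of_injective _ (hf_inj _ hz2), ← two_mul, latN]
    _ ≤ latN (p ^ k * m) :=
        Finset.card_le_card (Finset.union_subset (hf_mem _ hz1) (hf_mem _ hz2))

theorem two_pow_card_primeFactors_le_latN {m : ℕ} (hm : 0 < m)
    (h : ∃ x y : ℕ, m = x ^ 2 + y ^ 2) :
    2 ^ (m.primeFactors.filter (· % 4 = 1)).card ≤ latN m := by
  induction m using Nat.strong_induction_on with
  | _ m ih =>
    rcases (m.primeFactors.filter (· % 4 = 1)).eq_empty_or_nonempty with he | ⟨p, hpm⟩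
    · rw [he]
      exact latN_pos h
    · obtain ⟨hpm, h4⟩ := Finset.mem_filter.mp hpm
      have hp := Nat.prime_of_mem_primeFactors hpm
      have : Fact p.Prime := ⟨hp⟩
      obtain ⟨k, n, hpn, rfl⟩ := Nat.exists_eq_pow_mul_and_not_dvd hm.ne' p hp.ne_one
      have hn : 0 < n := Nat.pos_of_mul_pos_left hm
      have hk : k ≠ 0 := by
        rintro rfl
        exact hpn (by simpa using Nat.dvd_of_mem_primeFactors hpm)
      have hn_sq : ∃ x y : ℕ, n = x ^ 2 + y ^ 2 := by
        rw [Nat.eq_sq_add_sq_iff] at h ⊢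
        intro q hq hq3
        have hqp := Nat.prime_of_mem_primeFactors hq
        have : Fact q.Prime := ⟨hqp⟩
        have hqne : q ≠ p := by rintro rfl; omega
        have := h q (Nat.primeFactors_mono (dvd_mul_left _ _) hm.ne' hq) hq3
        rwa [padicValNat.mul (pow_ne_zero _ hp.ne_zero) hn.ne', padicValNat.pow,
          padicValNat_primes hqne, mul_zero, zero_add] at this
      have hcard : (((p ^ k * n).primeFactors).filter (· % 4 = 1)).card ≤
          (n.primeFactors.filter (· % 4 = 1)).card + 1 := by
        refine (Finset.card_le_card ?_).trans (Finset.card_insert_le p _)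
        rw [Nat.primeFactors_mul (pow_ne_zero _ hp.ne_zero) hn.ne',
          Nat.primeFactors_prime_pow hk hp]
        grind
      have hlt : n < p ^ k * n := lt_mul_of_one_lt_left hn (Nat.one_lt_pow hk hp.one_lt)
      calc 2 ^ (((p ^ k * n).primeFactors).filter (· % 4 = 1)).card
          ≤ 2 ^ ((n.primeFactors.filter (· % 4 = 1)).card + 1) :=
            Nat.pow_le_pow_right two_pos hcard
        _ = 2 * 2 ^ (n.primeFactors.filter (· % 4 = 1)).card := by ring
        _ ≤ 2 * latN n := Nat.mul_le_mul_left _ (ih n hlt hn hn_sq)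
        _ ≤ latN (p ^ k * n) := two_mul_latN_le hp h4 hk hpn

/-- A sum of two squares dividing `m` is a square times a product of distinct primes
dividing `m`, none of which is `3 mod 4`. -/
theorem exists_eq_sq_mul_prod_primes {d m : ℕ} (hm : m ≠ 0) (hdm : d ∣ m)
    (h : ∃ x y : ℕ, d = x ^ 2 + y ^ 2) :
    ∃ q : ℕ, ∃ T ⊆ m.primeFactors.filter (· % 4 ≠ 3), d = q ^ 2 * ∏ p ∈ T, p := by
  obtain ⟨a, b, hd, hb⟩ := Nat.eq_sq_add_sq_iff_eq_sq_mul.mp h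
  obtain ⟨e, c, hb', he⟩ := Nat.sq_mul_squarefree b
  have hed : e ∣ d := ⟨a ^ 2 * c ^ 2, by rw [hd, ← hb']; ring⟩
  have hsq : IsSquare (-1 : ZMod e) := ZMod.isSquare_neg_one_of_dvd ⟨c ^ 2, by rw [← hb']; ring⟩ hb
  refine ⟨a * c, e.primeFactors, fun p hp => Finset.mem_filter.mpr
    ⟨Nat.primeFactors_mono (hed.trans hdm) hm hp, ?_⟩, ?_⟩
  · exact (ZMod.isSquare_neg_one_iff' he).mp hsq (Nat.dvd_of_mem_primeFactors hp)
  · rw [Nat.prod_primeFactors_of_squarefree he, hd, ← hb']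
    ring

theorem sum_inv_sqrt_le_harmonic_mul_prod {D S : Finset ℕ} {K : ℕ}
    (h : ∀ d ∈ D, ∃ q ∈ Finset.Icc 1 K, ∃ T ⊆ S, d = q ^ 2 * ∏ p ∈ T, p) :
    ∑ d ∈ D, (√(d : ℝ))⁻¹ ≤ (harmonic K : ℝ) * ∏ p ∈ S, (1 + (√(p : ℝ))⁻¹) := by
  have h' : ∀ d : ℕ, ∃ x : ℕ × Finset ℕ, d ∈ D →
      x ∈ Finset.Icc 1 K ×ˢ S.powerset ∧ d = x.1 ^ 2 * ∏ p ∈ x.2, p := by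
    intro d
    by_cases hd : d ∈ D
    · obtain ⟨q, hq, T, hT, hdq⟩ := h d hd
      exact ⟨(q, T), fun _ => ⟨Finset.mem_product.mpr ⟨hq, Finset.mem_powerset.mpr hT⟩, hdq⟩⟩
    · exact ⟨(0, ∅), fun hd' => absurd hd' hd⟩
  choose c hc using h'
  have hinj : Set.InjOn c D := by
    intro x hx y hy hxy
    rw [(hc x hx).2, (hc y hy).2, hxy]
  calc ∑ d ∈ D, (√(d : ℝ))⁻¹
      = ∑ d ∈ D, ((c d).1 : ℝ)⁻¹ * ∏ p ∈ (c d).2, (√(p : ℝ))⁻¹ := by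
        refine Finset.sum_congr rfl fun d hd => ?_
        conv_lhs => rw [(hc d hd).2]
        push_cast
        rw [Real.sqrt_mul (by positivity), Real.sqrt_sq (by positivity), mul_inv,
          Real.sqrt_prod _ (fun _ _ => by positivity), Finset.prod_inv_distrib]
    _ = ∑ x ∈ D.image c, (x.1 : ℝ)⁻¹ * ∏ p ∈ x.2, (√(p : ℝ))⁻¹ :=
        (Finset.sum_image (f := fun x : ℕ × Finset ℕ =>
          (x.1 : ℝ)⁻¹ * ∏ p ∈ x.2, (√(p : ℝ))⁻¹) hinj).symm
    _ ≤ ∑ x ∈ Finset.Icc 1 K ×ˢ S.powerset, (x.1 : ℝ)⁻¹ * ∏ p ∈ x.2, (√(p : ℝ))⁻¹ :=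
        Finset.sum_le_sum_of_subset_of_nonneg
          (Finset.image_subset_iff.mpr fun d hd => (hc d hd).1) fun _ _ _ => by positivity
    _ = (harmonic K : ℝ) * ∏ p ∈ S, (1 + (√(p : ℝ))⁻¹) := by
        rw [Finset.prod_one_add, harmonic_eq_sum_Icc]
        push_cast
        rw [Finset.sum_mul_sum, Finset.sum_product]

theorem prod_one_add_inv_sqrt_le {δ : ℝ} (hδ : 0 < δ) (S : Finset ℕ) :
    ∏ p ∈ S, (1 + (√(p : ℝ))⁻¹) ≤ exp (⌈(δ ^ 2)⁻¹⌉₊ + δ * S.card) := by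
  set M := ⌈(δ ^ 2)⁻¹⌉₊
  have hterm (p : ℕ) : (√(p : ℝ))⁻¹ ≤ (if p ∈ Finset.range M then 1 else 0) + δ := by
    split_ifs with hp
    · rcases Nat.eq_zero_or_pos p with rfl | h0
      · simp only [Nat.cast_zero, Real.sqrt_zero, inv_zero]
        positivity
      · have : (√(p : ℝ))⁻¹ ≤ 1 := inv_le_one_of_one_le₀ (by
          rw [Real.one_le_sqrt]
          exact_mod_cast h0)
        linarith
    · rw [Finset.mem_range, not_lt] at hp
      have hp' : (δ ^ 2)⁻¹ ≤ p := (Nat.le_ceil _).trans (by exact_mod_cast hp)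
      rw [zero_add]
      apply inv_le_of_inv_le₀ hδ
      apply Real.le_sqrt_of_sq_le
      rwa [inv_pow]
  calc ∏ p ∈ S, (1 + (√(p : ℝ))⁻¹)
      ≤ ∏ p ∈ S, exp ((√(p : ℝ))⁻¹) :=
        Finset.prod_le_prod (fun _ _ => by positivity) fun p _ => by
          linarith [Real.add_one_le_exp ((√(p : ℝ))⁻¹)]
    _ = exp (∑ p ∈ S, (√(p : ℝ))⁻¹) := (Real.exp_sum _ _).symm
    _ ≤ exp (M + δ * S.card) := by
        refine Real.exp_le_exp.mpr ((Finset.sum_le_sum fun p _ => hterm p).trans ?_)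
        rw [Finset.sum_add_distrib, Finset.sum_const, nsmul_eq_mul, mul_comm, Finset.sum_boole]
        gcongr
        refine (Finset.card_le_card fun x hx => (Finset.mem_filter.mp hx).2).trans ?_
        rw [Finset.card_range]

open scoped Classical in
/-- The sum of `1/√d` over divisors `d < N^α` of `m` which are sums of two squares
is `O_ε(N^ε)`. -/
theorem divisor_sum_bound :
    ∀ α > (0:ℝ), ∀ ε > (0:ℝ), ∃ C > 0, ∀ m : ℕ, 0 < m →
      (∃ a b : ℤ, a ^ 2 + b ^ 2 = (m : ℤ)) →
      (∑ d ∈ m.divisors,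
          if (d : ℝ) < (latN m : ℝ) ^ α ∧ (∃ a b : ℤ, (d : ℤ) = a ^ 2 + b ^ 2) then
            (Real.sqrt d)⁻¹
          else 0)
        ≤ C * (latN m : ℝ) ^ ε := by
  intro α hα ε hε
  have natAbs_sq {n : ℕ} {a b : ℤ} (h : (n : ℤ) = a ^ 2 + b ^ 2) :
      ∃ x y : ℕ, n = x ^ 2 + y ^ 2 :=
    ⟨a.natAbs, b.natAbs, by zify; simpa using h⟩
  set δ : ℝ := ε / 2 * log 2 with hδ_def
  have hδ : 0 < δ := by positivity
  refine ⟨(1 + α / (ε / 2)) * exp (⌈(δ ^ 2)⁻¹⌉₊ + δ), by positivity, fun m hm ⟨a, b, hab⟩ => ?_⟩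
  have hm_sq := natAbs_sq hab.symm
  have hN1 : (1 : ℝ) ≤ latN m := by exact_mod_cast latN_pos hm_sq
  have hN0 : (0 : ℝ) < latN m := by linarith
  set N : ℝ := (latN m : ℝ)
  set S := m.primeFactors.filter (· % 4 ≠ 3)
  have hcard : S.card ≤ (m.primeFactors.filter (· % 4 = 1)).card + 1 := by
    refine (Finset.card_le_card fun p hp => ?_).trans (Finset.card_insert_le 2 _)
    obtain ⟨hp, hp3⟩ := Finset.mem_filter.mp hp
    rcases (Nat.prime_of_mem_primeFactors hp).eq_two_or_odd with h2 | hodd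
    · exact Finset.mem_insert.mpr (Or.inl h2)
    · exact Finset.mem_insert_of_mem (Finset.mem_filter.mpr ⟨hp, by omega⟩)
  have hpow : exp (δ * S.card) ≤ exp δ * N ^ (ε / 2) := by
    set r := (m.primeFactors.filter (· % 4 = 1)).card
    have h2 : (2 : ℝ) ^ r ≤ N := by
      simpa [N] using (Nat.cast_le (α := ℝ)).mpr (two_pow_card_primeFactors_le_latN hm hm_sq)
    have hlog : r * log 2 ≤ log N := by
      rw [← Real.log_pow]
      exact Real.log_le_log (by positivity) h2
    have hcard' : (S.card : ℝ) ≤ r + 1 := by exact_mod_cast hcard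
    rw [Real.rpow_def_of_pos hN0, ← Real.exp_add, Real.exp_le_exp]
    nlinarith [mul_le_mul_of_nonneg_left hcard' hδ.le,
      mul_le_mul_of_nonneg_left hlog (half_pos hε).le]
  have hharm : (harmonic ⌊N ^ α⌋₊ : ℝ) ≤ (1 + α / (ε / 2)) * N ^ (ε / 2) := by
    have h1 : (1 : ℝ) ≤ N ^ α := Real.one_le_rpow hN1 hα.le
    have hfl : 0 < ⌊N ^ α⌋₊ := Nat.floor_pos.mpr h1
    calc (harmonic ⌊N ^ α⌋₊ : ℝ) ≤ 1 + log (⌊N ^ α⌋₊ : ℝ) := harmonic_le_one_add_log _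
      _ ≤ 1 + log (N ^ α) := by
          gcongr
          exact Nat.floor_le (by positivity)
      _ = 1 + α * log N := by rw [Real.log_rpow hN0]
      _ ≤ N ^ (ε / 2) + α * (N ^ (ε / 2) / (ε / 2)) := by
          gcongr
          · exact Real.one_le_rpow hN1 (by positivity)
          · exact Real.log_le_rpow_div hN0.le (by positivity)
      _ = (1 + α / (ε / 2)) * N ^ (ε / 2) := by ring
  rw [← Finset.sum_filter]
  calc _ ≤ (harmonic ⌊N ^ α⌋₊ : ℝ) * ∏ p ∈ S, (1 + (√(p : ℝ))⁻¹) := by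
        refine sum_inv_sqrt_le_harmonic_mul_prod fun d hd => ?_
        obtain ⟨hd, hdN, a, b, hdab⟩ := Finset.mem_filter.mp hd
        have hdm := Nat.dvd_of_mem_divisors hd
        have hd0 : 0 < d := Nat.pos_of_mem_divisors hd
        obtain ⟨q, T, hT, hdq⟩ := exists_eq_sq_mul_prod_primes hm.ne' hdm (natAbs_sq hdab)
        refine ⟨q, Finset.mem_Icc.mpr ⟨?_, ?_⟩, T, hT, hdq⟩
        · rw [Nat.one_le_iff_ne_zero]
          rintro rfl
          simp [hdq] at hd0
        · have hqd : q ≤ d := Nat.le_of_dvd hd0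
            ((dvd_pow_self q two_ne_zero).trans ⟨_, hdq⟩)
          exact hqd.trans (Nat.le_floor hdN.le)
    _ ≤ ((1 + α / (ε / 2)) * N ^ (ε / 2)) *
          (exp ⌈(δ ^ 2)⁻¹⌉₊ * (exp δ * N ^ (ε / 2))) := by
        refine mul_le_mul hharm ?_ (Finset.prod_nonneg fun _ _ => by positivity) (by positivity)
        refine (prod_one_add_inv_sqrt_le hδ S).trans ?_
        rw [Real.exp_add]
        gcongr
    _ = (1 + α / (ε / 2)) * exp (⌈(δ ^ 2)⁻¹⌉₊ + δ) * N ^ ε := by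
        rw [Real.exp_add, ← add_halves ε, Real.rpow_add hN0, add_halves]
        ring

end
end

section
/- There exists a constant C > 0, depending only on γ, such that for every positive integer m which is a sum of two squares, the following four bounds hold: ∫₀ᴸ∫₀ᴸ r(t₁,t₂)⁴ dt₁ dt₂ ≤ C · N^{-3/2}; m^{-2} ∫₀ᴸ∫₀ᴸ r₁(t₁,t₂)⁴ dt₁ dt₂ ≤ C · N^{-3/2}; m^{-2} ∫₀ᴸ∫₀ᴸ r₂(t₁,t₂)⁴ dt₁ dt₂ ≤ C · N^{-3/2}; and m^{-4} ∫₀ᴸ∫₀ᴸ r₁₂(t₁,t₂)⁴ dt₁ dt₂ ≤ C · N^{-3/2}, where N = #{μ ∈ ℤ² : μ₁² + μ₂² = m}. -/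
open MeasureTheory ProbabilityTheory Real

noncomputable section

/-- The covariance function of the wave restricted to the curve:
`r(t₁,t₂) = N⁻¹ ∑_{μ ∈ E} cos(2π⟨μ, γ(t₁) − γ(t₂)⟩)`. -/
def covFn (m : ℕ) (γ : ℝ → ℝ × ℝ) (t₁ t₂ : ℝ) : ℝ :=
  ((latN m : ℝ))⁻¹ *
    ∑ μ ∈ latticeSet m,
      Real.cos (2 * π * ((μ.1 : ℝ) * (γ t₁ - γ t₂).1 + (μ.2 : ℝ) * (γ t₁ - γ t₂).2))

/-- `r₁ = ∂r/∂t₁`. -/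
def covFn1 (m : ℕ) (γ : ℝ → ℝ × ℝ) (t₁ t₂ : ℝ) : ℝ :=
  deriv (fun s => covFn m γ s t₂) t₁

/-- `r₂ = ∂r/∂t₂`. -/
def covFn2 (m : ℕ) (γ : ℝ → ℝ × ℝ) (t₁ t₂ : ℝ) : ℝ :=
  deriv (fun s => covFn m γ t₁ s) t₂

/-- `r₁₂ = ∂²r/∂t₁∂t₂`. -/
def covFn12 (m : ℕ) (γ : ℝ → ℝ × ℝ) (t₁ t₂ : ℝ) : ℝ :=
  deriv (fun s => deriv (fun u => covFn m γ s u) t₂) t₁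

theorem mem_latticeSet_s16 {m : ℕ} {μ : ℤ × ℤ} :
    μ ∈ latticeSet m ↔ μ.1 ^ 2 + μ.2 ^ 2 = (m : ℤ) := by
  simp only [latticeSet, Finset.mem_filter, Finset.mem_product, Finset.mem_Icc]
  refine ⟨fun h => h.2, fun h => ⟨?_, h⟩⟩
  have h1 := sq_nonneg μ.1
  have h2 := sq_nonneg μ.2
  have h3 := abs_le.1 (abs_le_of_sq_le_sq' (a := μ.1) (b := m) (by nlinarith) (by positivity) |> abs_le.2)
  have h4 := abs_le.1 (abs_le_of_sq_le_sq' (a := μ.2) (b := m) (by nlinarith) (by positivity) |> abs_le.2)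
  exact ⟨h3, h4⟩

/-- Every Gaussian integer of norm `a * b`, with `a` and `b` coprime, is a product of Gaussian
integers of norms `a` and `b`. -/
theorem exists_mul_eq_of_norm_eq_mul {a b : ℕ} (ha : 0 < a) (hb : 0 < b) (hab : a.Coprime b)
    (z : GaussianInt) (hz : z.norm = (a * b : ℕ)) :
    ∃ x y : GaussianInt, x.norm = a ∧ y.norm = b ∧ x * y = z := by
  set g := EuclideanDomain.gcd z (a : GaussianInt) with hg
  set h := EuclideanDomain.gcd z (b : GaussianInt) with hh
  have norm_dvd : ∀ {x y : GaussianInt}, x ∣ y → x.norm ∣ y.norm := by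
    rintro x y ⟨w, rfl⟩
    exact ⟨w.norm, Zsqrtd.norm_mul _ _⟩
  have key : ∀ c d : ℕ, c.Coprime d → z.norm = (c * d : ℕ) →
      (EuclideanDomain.gcd z (c : GaussianInt)).norm ∣ (c : ℤ) := by
    intro c d hcd hzc
    have h1 := norm_dvd (EuclideanDomain.gcd_dvd_left z (c : GaussianInt))
    have h2 := norm_dvd (EuclideanDomain.gcd_dvd_right z (c : GaussianInt))
    rw [hzc] at h1
    rw [Zsqrtd.norm_natCast] at h2
    have h3 := Int.dvd_coe_gcd h1 h2
    have h4 : Int.gcd ((c * d : ℕ) : ℤ) ((c : ℤ) * c) = c := by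
      rw [show ((c : ℤ) * c) = ((c * c : ℕ) : ℤ) by push_cast; ring, Int.gcd_natCast_natCast,
        Nat.gcd_mul_left, Nat.gcd_comm, hcd.gcd_eq_one, mul_one]
    rwa [h4] at h3
  have hga : g.norm ∣ (a : ℤ) := key a b hab hz
  have hhb : h.norm ∣ (b : ℤ) := key b a hab.symm (by rw [hz, mul_comm])
  have hzgh : z ∣ g * h := by
    rw [hg, hh, EuclideanDomain.gcd_eq_gcd_ab z (a : GaussianInt),
      EuclideanDomain.gcd_eq_gcd_ab z (b : GaussianInt)]
    have hzab : z ∣ (a : GaussianInt) * b := by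
      refine ⟨star z, ?_⟩
      rw [← Zsqrtd.norm_eq_mul_conj, hz]
      push_cast
      rfl
    generalize EuclideanDomain.gcdA z (a : GaussianInt) = x
    generalize EuclideanDomain.gcdB z (a : GaussianInt) = y
    generalize EuclideanDomain.gcdA z (b : GaussianInt) = x'
    generalize EuclideanDomain.gcdB z (b : GaussianInt) = y'
    have e : (z * x + a * y) * (z * x' + b * y') =
        z * (x * (z * x' + b * y') + a * y * x') + (a * b) * (y * y') := by ring
    rw [e]
    exact dvd_add (dvd_mul_right _ _) (hzab.mul_right _)
  obtain ⟨u, hu⟩ := hzgh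
  have hgn : 0 ≤ g.norm := GaussianInt.norm_nonneg g
  have hhn : 0 ≤ h.norm := GaussianInt.norm_nonneg h
  have hun : 0 ≤ u.norm := GaussianInt.norm_nonneg u
  have hnorm : g.norm * h.norm = (a * b : ℕ) * u.norm := by
    rw [← hz, ← Zsqrtd.norm_mul, ← Zsqrtd.norm_mul, hu]
  have ha' : (0 : ℤ) < a := by exact_mod_cast ha
  have hb' : (0 : ℤ) < b := by exact_mod_cast hb
  have hgle := Int.le_of_dvd ha' hga
  have hhle := Int.le_of_dvd hb' hhb
  have hg0 : 0 < g.norm := lt_of_le_of_ne hgn fun h0 => by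
    rw [← h0, zero_dvd_iff] at hga; omega
  have hh0 : 0 < h.norm := lt_of_le_of_ne hhn fun h0 => by
    rw [← h0, zero_dvd_iff] at hhb; omega
  push_cast at hnorm
  have hu1 : u.norm = 1 := by
    have h1 : 0 < u.norm := by
      by_contra hc
      have : u.norm = 0 := by omega
      rw [this] at hnorm
      nlinarith [mul_pos hg0 hh0]
    have h2 : (a : ℤ) * b * u.norm ≤ a * b * 1 := by
      rw [← hnorm, mul_one]
      exact mul_le_mul hgle hhle hhn ha'.le
    have := le_of_mul_le_mul_left h2 (mul_pos ha' hb')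
    omega
  rw [hu1, mul_one] at hnorm
  have hgeq : g.norm = a := by nlinarith
  have hheq : h.norm = b := by nlinarith
  refine ⟨g, h * star u, hgeq, ?_, ?_⟩
  · rw [Zsqrtd.norm_mul, Zsqrtd.norm_conj, hu1, hheq, mul_one]
  · rw [← mul_assoc, hu, mul_assoc, ← Zsqrtd.norm_eq_mul_conj, hu1]
    simp

theorem latN_mul_le {a b : ℕ} (ha : 0 < a) (hb : 0 < b) (hab : a.Coprime b) :
    latN (a * b) ≤ latN a * latN b := by
  unfold latN
  rw [← Finset.card_product]
  refine (Finset.card_le_card ?_).trans (Finset.card_image_le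
    (f := fun q : (ℤ × ℤ) × (ℤ × ℤ) =>
      (q.1.1 * q.2.1 - q.1.2 * q.2.2, q.1.1 * q.2.2 + q.1.2 * q.2.1)))
  intro μ hμ
  rw [mem_latticeSet_s16] at hμ
  obtain ⟨x, y, hx, hy, hxy⟩ := exists_mul_eq_of_norm_eq_mul ha hb hab ⟨μ.1, μ.2⟩
    (by rw [← hμ, Zsqrtd.norm_def]; ring)
  rw [Finset.mem_image]
  refine ⟨((x.re, x.im), (y.re, y.im)), ?_, ?_⟩
  · rw [Finset.mem_product, mem_latticeSet_s16, mem_latticeSet_s16, ← hx, ← hy, Zsqrtd.norm_def,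
      Zsqrtd.norm_def]
    constructor <;> ring
  · have h1 := congrArg Zsqrtd.re hxy
    have h2 := congrArg Zsqrtd.im hxy
    simp only [Zsqrtd.re_mul, Zsqrtd.im_mul] at h1 h2
    ext
    · simp only [← h1]; ring
    · simp only [← h2]

/-- Two primitive representations of a prime power as a sum of two squares. -/
theorem prime_pow_dvd_of_primitive {p k : ℕ} (hp : p.Prime) {a b c d : ℤ}
    (h1 : a ^ 2 + b ^ 2 = ((p ^ k : ℕ) : ℤ)) (h2 : c ^ 2 + d ^ 2 = ((p ^ k : ℕ) : ℤ))
    (ha : ¬ ((p : ℤ) ∣ a ∧ (p : ℤ) ∣ b)) (hc : ¬ ((p : ℤ) ∣ c ∧ (p : ℤ) ∣ d)) :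
    ((p ^ k : ℕ) : ℤ) ∣ b * c - a * d ∨ ((p ^ k : ℕ) : ℤ) ∣ b * c + a * d := by
  have hpp : Prime (p : ℤ) := Nat.prime_iff_prime_int.1 hp
  have hprod : ((p ^ k : ℕ) : ℤ) ∣ (b * c - a * d) * (b * c + a * d) := by
    refine ⟨b ^ 2 - d ^ 2, ?_⟩
    linear_combination (b ^ 2 : ℤ) * h2 - d ^ 2 * h1
  rcases Nat.eq_zero_or_pos k with rfl | hk
  · left; simp
  rcases Nat.lt_or_ge 1 k with hk1 | hk1
  swap
  · obtain rfl : k = 1 := by omega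
    rw [pow_one] at hprod ⊢
    exact hpp.dvd_or_dvd hprod
  have hdp : (p : ℤ) ∣ ((p ^ k : ℕ) : ℤ) := by exact_mod_cast dvd_pow_self p (by omega)
  have aux : ∀ x y : ℤ, x ^ 2 + y ^ 2 = ((p ^ k : ℕ) : ℤ) → (p : ℤ) ∣ x → (p : ℤ) ∣ y := by
    intro x y hxy hx
    have : (p : ℤ) ∣ y ^ 2 := by
      have h3 : y ^ 2 = ((p ^ k : ℕ) : ℤ) - x ^ 2 := by linarith
      rw [h3]
      exact dvd_sub hdp (dvd_pow hx two_ne_zero)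
    exact hpp.dvd_of_dvd_pow this
  have hna : ¬ (p : ℤ) ∣ a := fun h => ha ⟨h, aux a b h1 h⟩
  have hnd : ¬ (p : ℤ) ∣ d := fun h => hc ⟨aux d c (by linarith) h, h⟩
  have hp2 : p ≠ 2 := by
    rintro rfl
    have h4 : (4 : ℤ) ∣ ((2 ^ k : ℕ) : ℤ) := by exact_mod_cast pow_dvd_pow 2 hk1
    rw [← h1] at h4
    have hb : ¬ (2 : ℤ) ∣ b := fun h => hna (aux b a (by linarith) h)
    have ha2 : a % 2 = 1 := by push_cast at hna; omega
    have hb2 : b % 2 = 1 := by omega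
    obtain ⟨r, hr⟩ : ∃ r, a = 2 * r + 1 := ⟨a / 2, by omega⟩
    obtain ⟨s, hs⟩ : ∃ s, b = 2 * s + 1 := ⟨b / 2, by omega⟩
    have : a ^ 2 + b ^ 2 = 4 * (r ^ 2 + r + s ^ 2 + s) + 2 := by rw [hr, hs]; ring
    omega
  have hnot : ¬ ((p : ℤ) ∣ b * c - a * d ∧ (p : ℤ) ∣ b * c + a * d) := by
    rintro ⟨h5, h6⟩
    have h7 : (p : ℤ) ∣ 2 * (a * d) := by
      have := dvd_sub h6 h5
      rwa [show b * c + a * d - (b * c - a * d) = 2 * (a * d) by ring] at this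
    rcases hpp.dvd_or_dvd h7 with h8 | h8
    · have : p ∣ 2 := by exact_mod_cast h8
      exact hp2 ((Nat.prime_dvd_prime_iff_eq hp Nat.prime_two).1 this)
    · rcases hpp.dvd_or_dvd h8 with h9 | h9
      · exact hna h9
      · exact hnd h9
  push_cast at hprod ⊢
  by_cases h5 : (p : ℤ) ∣ b * c - a * d
  · left
    exact hpp.pow_dvd_of_dvd_mul_right k (fun h6 => hnot ⟨h5, h6⟩) hprod
  · right
    exact hpp.pow_dvd_of_dvd_mul_left k h5 hprod

/-- A Gaussian integer of norm `q` is determined by `(c, d)` and the coordinates of the product. -/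
theorem mem_image_of_dvd {q : ℤ} (hq : 0 < q) {a b c d : ℤ} (h1 : a ^ 2 + b ^ 2 = q)
    (h2 : c ^ 2 + d ^ 2 = q) (h : q ∣ b * c - a * d) :
    ∃ u ∈ Finset.Icc (-1 : ℤ) 1, ∃ v ∈ Finset.Icc (-1 : ℤ) 1,
      a = u * c - v * d ∧ b = u * d + v * c := by
  obtain ⟨v, hv⟩ := h
  have hsq : (a * c + b * d) ^ 2 = q ^ 2 * (1 - v ^ 2) := by
    have : (a * c + b * d) ^ 2 + (b * c - a * d) ^ 2 = q ^ 2 := by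
      rw [show q ^ 2 = q * q by ring]
      nth_rw 1 [← h1]
      rw [← h2]; ring
    rw [hv] at this
    linear_combination this
  obtain ⟨u, hu⟩ : q ∣ a * c + b * d := by
    rw [← Int.pow_dvd_pow_iff two_ne_zero, hsq]
    exact dvd_mul_right _ _
  rw [hu] at hsq
  have huv : u ^ 2 + v ^ 2 = 1 := by
    have hq2 : q ^ 2 ≠ 0 := by positivity
    apply mul_left_cancel₀ hq2
    linear_combination hsq
  refine ⟨u, ?_, v, ?_, ?_, ?_⟩
  · rw [Finset.mem_Icc]; constructor <;> nlinarith [sq_nonneg u, sq_nonneg v]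
  · rw [Finset.mem_Icc]; constructor <;> nlinarith [sq_nonneg u, sq_nonneg v]
  · apply mul_left_cancel₀ hq.ne'
    linear_combination c * hu - d * hv - a * h2
  · apply mul_left_cancel₀ hq.ne'
    linear_combination d * hu + c * hv - b * h2

theorem card_primitive_le {p : ℕ} (k : ℕ) (hp : p.Prime) :
    ((latticeSet (p ^ k)).filter (fun μ => ¬ ((p : ℤ) ∣ μ.1 ∧ (p : ℤ) ∣ μ.2))).card ≤ 18 := by
  rcases Finset.eq_empty_or_nonempty
    ((latticeSet (p ^ k)).filter (fun μ => ¬ ((p : ℤ) ∣ μ.1 ∧ (p : ℤ) ∣ μ.2))) with h0 | ⟨ν, hν⟩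
  · rw [h0]; simp
  rw [Finset.mem_filter, mem_latticeSet_s16] at hν
  set B := Finset.Icc (-1 : ℤ) 1 ×ˢ Finset.Icc (-1 : ℤ) 1
  set T := B.image (fun w => (w.1 * ν.1 - w.2 * ν.2, w.1 * ν.2 + w.2 * ν.1)) ∪
    B.image (fun w => (w.1 * ν.1 + w.2 * ν.2, - w.1 * ν.2 + w.2 * ν.1))
  have hq : (0 : ℤ) < ((p ^ k : ℕ) : ℤ) := by exact_mod_cast pow_pos hp.pos k
  have hsub : ((latticeSet (p ^ k)).filter
      (fun μ => ¬ ((p : ℤ) ∣ μ.1 ∧ (p : ℤ) ∣ μ.2))) ⊆ T := by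
    intro μ hμ
    rw [Finset.mem_filter, mem_latticeSet_s16] at hμ
    rw [Finset.mem_union, Finset.mem_image, Finset.mem_image]
    rcases prime_pow_dvd_of_primitive hp hμ.1 hν.1 hμ.2 hν.2 with h | h
    · left
      obtain ⟨u, hu, v, hv, h1, h2⟩ := mem_image_of_dvd hq hμ.1 hν.1 h
      exact ⟨(u, v), Finset.mem_product.2 ⟨hu, hv⟩, Prod.ext h1.symm h2.symm⟩
    · right
      obtain ⟨u, hu, v, hv, h1, h2⟩ := mem_image_of_dvd (c := ν.1) (d := -ν.2) hq hμ.1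
        (by rw [neg_sq]; exact hν.1) (by rwa [mul_neg, sub_neg_eq_add])
      refine ⟨(u, v), Finset.mem_product.2 ⟨hu, hv⟩, Prod.ext ?_ ?_⟩
      · simp only [h1]; ring
      · simp only [h2]; ring
  refine (Finset.card_le_card hsub).trans ((Finset.card_union_le _ _).trans ?_)
  have hB : B.card = 9 := by decide
  exact (add_le_add Finset.card_image_le Finset.card_image_le).trans (by rw [hB])

theorem latN_prime_pow_le {p : ℕ} (hp : p.Prime) (k : ℕ) : latN (p ^ k) ≤ 18 * (k + 1) := by
  induction k using Nat.strong_induction_on with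
  | _ k ih =>
    have hsplit := Finset.card_filter_add_card_filter_not (s := latticeSet (p ^ k))
      (fun μ => ((p : ℤ) ∣ μ.1 ∧ (p : ℤ) ∣ μ.2))
    have hprim := card_primitive_le k hp
    have hpp : Prime (p : ℤ) := Nat.prime_iff_prime_int.1 hp
    have hp0 : (p : ℤ) ≠ 0 := hpp.ne_zero
    have himp : ((latticeSet (p ^ k)).filter
        (fun μ => ((p : ℤ) ∣ μ.1 ∧ (p : ℤ) ∣ μ.2))).card ≤ 18 * k := by
      rcases Nat.lt_or_ge k 2 with hk | hk
      · have : ((latticeSet (p ^ k)).filter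
            (fun μ => ((p : ℤ) ∣ μ.1 ∧ (p : ℤ) ∣ μ.2))) = ∅ := by
          rw [Finset.filter_eq_empty_iff]
          rintro μ hμ ⟨⟨x, hx⟩, ⟨y, hy⟩⟩
          rw [mem_latticeSet_s16, hx, hy] at hμ
          have h1 : (p ^ 2 : ℕ) ∣ p ^ k := by
            have : ((p ^ 2 : ℕ) : ℤ) ∣ ((p ^ k : ℕ) : ℤ) :=
              ⟨x ^ 2 + y ^ 2, by rw [← hμ]; push_cast; ring⟩
            exact_mod_cast this
          have := (Nat.pow_dvd_pow_iff_le_right hp.one_lt).1 h1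
          omega
        rw [this]; simp
      · obtain ⟨j, rfl⟩ : ∃ j, k = j + 2 := ⟨k - 2, by omega⟩
        refine le_trans ?_ ((ih j (by omega)).trans (by omega))
        unfold latN
        refine (Finset.card_le_card ?_).trans (Finset.card_image_le
          (f := fun ν : ℤ × ℤ => ((p : ℤ) * ν.1, (p : ℤ) * ν.2)))
        intro μ hμ
        rw [Finset.mem_filter, mem_latticeSet_s16] at hμ
        obtain ⟨hμ, ⟨x, hx⟩, ⟨y, hy⟩⟩ := hμ
        rw [Finset.mem_image]
        refine ⟨(x, y), ?_, Prod.ext hx.symm hy.symm⟩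
        rw [mem_latticeSet_s16]
        rw [hx, hy] at hμ
        apply mul_left_cancel₀ (pow_ne_zero 2 hp0)
        push_cast at hμ ⊢
        linear_combination hμ
    unfold latN
    omega

/-- The divisor-type bound `r₂(m) ≪ m^{1/9}`. -/
theorem exists_latN_pow_le : ∃ C : ℝ, 1 ≤ C ∧ ∀ m : ℕ, 0 < m → (latN m : ℝ) ^ 9 ≤ C * m := by
  obtain ⟨D, hD1, hD⟩ : ∃ D : ℝ, 1 ≤ D ∧ ∀ k : ℕ, ((18 * (k + 1) : ℕ) : ℝ) ^ 9 ≤ D * 2 ^ k := by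
    obtain ⟨D, hD⟩ := ((tendsto_pow_const_div_const_pow_of_one_lt 9
      (one_lt_two (α := ℝ))).bddAbove_range)
    refine ⟨max 1 (18 ^ 9 * 2 * D), le_max_left _ _, fun k => ?_⟩
    have h := hD ⟨k + 1, rfl⟩
    simp only at h
    rw [div_le_iff₀ (by positivity)] at h
    push_cast at h ⊢
    calc (18 * ((k : ℝ) + 1)) ^ 9 = 18 ^ 9 * ((k : ℝ) + 1) ^ 9 := by ring
      _ ≤ 18 ^ 9 * (D * 2 ^ (k + 1)) := by gcongr
      _ = (18 ^ 9 * 2 * D) * 2 ^ k := by ring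
      _ ≤ _ := by gcongr; exact le_max_right _ _
  obtain ⟨P, hP⟩ : ∃ P : ℕ, ∀ p k : ℕ, P ≤ p → 0 < k →
      ((18 * (k + 1) : ℕ) : ℝ) ^ 9 ≤ (p : ℝ) ^ k := by
    refine ⟨36 ^ 9, fun p k hp hk => ?_⟩
    have h1 : 18 * (k + 1) ≤ 36 ^ k := by
      have h2 : k + 1 ≤ 2 ^ k := Nat.lt_two_pow_self
      have h3 : 18 ≤ 18 ^ k := Nat.le_self_pow hk.ne' 18
      calc 18 * (k + 1) ≤ 18 ^ k * 2 ^ k := Nat.mul_le_mul h3 h2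
        _ = 36 ^ k := by rw [← mul_pow]; norm_num
    have h4 : (18 * (k + 1)) ^ 9 ≤ p ^ k := by
      calc (18 * (k + 1)) ^ 9 ≤ (36 ^ k) ^ 9 := Nat.pow_le_pow_left h1 9
        _ = (36 ^ 9) ^ k := by rw [← pow_mul, ← pow_mul, mul_comm]
        _ ≤ p ^ k := Nat.pow_le_pow_left hp k
    exact_mod_cast h4
  set c : ℕ → ℝ := fun p => if p < P then D else 1 with hc
  have hc1 : ∀ p, 1 ≤ c p := by
    intro p; simp only [hc]; split_ifs <;> linarith
  have main : ∀ m : ℕ, 0 < m → (latN m : ℝ) ^ 9 ≤ (latN 1 : ℝ) ^ 9 *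
      (∏ p ∈ m.primeFactors, c p) * m := by
    intro m hm
    rcases eq_or_ne m 1 with rfl | hm1
    · simp
    have h : m ≠ 0 → m ≠ 1 → (latN m : ℝ) ^ 9 ≤ (∏ p ∈ m.primeFactors, c p) * m := by
      clear hm hm1
      induction m using Nat.recOnPosPrimePosCoprime with
      | zero => intro h; exact absurd rfl h
      | one => intro _ h; exact absurd rfl h
      | prime_pow p k hp hk =>
        intro _ _
        rw [Nat.primeFactors_prime_pow hk.ne' hp, Finset.prod_singleton]
        have h1 : (latN (p ^ k) : ℝ) ^ 9 ≤ ((18 * (k + 1) : ℕ) : ℝ) ^ 9 := by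
          gcongr
          exact latN_prime_pow_le hp k
        refine h1.trans ?_
        push_cast [hc]
        split_ifs with hlt
        · have := hD k
          push_cast at this
          refine this.trans ?_
          gcongr
          exact_mod_cast hp.two_le
        · have := hP p k (by omega) hk
          push_cast at this
          rwa [one_mul]
      | coprime a b ha hb hab iha ihb =>
        intro _ _
        have iha := iha (by omega) (by omega)
        have ihb := ihb (by omega) (by omega)
        rw [hab.primeFactors_mul, Finset.prod_union hab.disjoint_primeFactors]
        have h1 : (latN (a * b) : ℝ) ≤ latN a * latN b := by
          exact_mod_cast latN_mul_le (by omega) (by omega) hab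
        have hpa : 0 ≤ ∏ p ∈ a.primeFactors, c p :=
          Finset.prod_nonneg fun p _ => zero_le_one.trans (hc1 p)
        calc (latN (a * b) : ℝ) ^ 9 ≤ (latN a * latN b) ^ 9 := by gcongr
          _ = (latN a : ℝ) ^ 9 * (latN b : ℝ) ^ 9 := by ring
          _ ≤ _ := mul_le_mul iha ihb (by positivity) (by positivity)
          _ = _ := by push_cast; ring
    refine (h hm.ne' hm1).trans ?_
    have h1 : (1 : ℝ) ≤ (latN 1 : ℝ) ^ 9 := by
      apply one_le_pow₀
      have : 0 < latN 1 := Finset.card_pos.2 ⟨(1, 0), by rw [mem_latticeSet_s16]; norm_num⟩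
      exact_mod_cast this
    have hpa : 0 ≤ ∏ p ∈ m.primeFactors, c p :=
      Finset.prod_nonneg fun p _ => zero_le_one.trans (hc1 p)
    rw [mul_assoc]
    exact le_mul_of_one_le_left (by positivity) h1
  have hprod : ∀ m : ℕ, ∏ p ∈ m.primeFactors, c p ≤ D ^ P := by
    intro m
    calc ∏ p ∈ m.primeFactors, c p = ∏ p ∈ m.primeFactors with p < P, D := by
          rw [Finset.prod_filter]
      _ = D ^ (m.primeFactors.filter (· < P)).card := by rw [Finset.prod_const]
      _ ≤ D ^ P := by
        apply pow_le_pow_right₀ hD1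
        calc _ ≤ (Finset.range P).card := Finset.card_le_card fun p hp => by
              rw [Finset.mem_filter] at hp
              exact Finset.mem_range.2 hp.2
          _ = P := Finset.card_range P
  refine ⟨max 1 ((latN 1 : ℝ) ^ 9 * D ^ P), le_max_left _ _, fun m hm => ?_⟩
  refine (main m hm).trans ?_
  refine mul_le_mul_of_nonneg_right (le_trans ?_ (le_max_right _ _)) (Nat.cast_nonneg m)
  exact mul_le_mul_of_nonneg_left (hprod m) (by positivity)

/-- The decay weight attached to a frequency `v ∈ ℤ²`. -/
def freqWeight (v : ℤ × ℤ) : ℝ := (√(1 + (v.1 : ℝ) ^ 2 + (v.2 : ℝ) ^ 2))⁻¹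

theorem freqWeight_nonneg (v : ℤ × ℤ) : 0 ≤ freqWeight v := by
  unfold freqWeight; positivity

theorem sum_inv_sqrt_le (M : ℕ) :
    ∑ a ∈ Finset.Icc (-(M : ℤ)) M, (√(1 + |(a : ℝ)|))⁻¹ ≤ 4 * √(M + 1) := by
  induction M with
  | zero => simp
  | succ M ih =>
    have hI : Finset.Icc (-((M + 1 : ℕ) : ℤ)) ((M + 1 : ℕ) : ℤ) =
        insert (-((M + 1 : ℕ) : ℤ)) (insert ((M + 1 : ℕ) : ℤ) (Finset.Icc (-(M : ℤ)) M)) := by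
      ext x
      simp only [Finset.mem_Icc, Finset.mem_insert]
      push_cast
      omega
    have hpos : (0 : ℝ) ≤ (M : ℝ) + 1 := by positivity
    rw [hI, Finset.sum_insert, Finset.sum_insert]
    · push_cast
      rw [abs_neg, abs_of_nonneg hpos]
      have e : 1 + ((M : ℝ) + 1) = M + 1 + 1 := by ring
      rw [e]
      have h1 : 0 < √((M : ℝ) + 1 + 1) := by positivity
      have h2 : √((M : ℝ) + 1) ≤ √((M : ℝ) + 1 + 1) := Real.sqrt_le_sqrt (by linarith)
      have h3 : √((M : ℝ) + 1 + 1) ^ 2 = M + 1 + 1 := Real.sq_sqrt (by linarith)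
      have h4 : √((M : ℝ) + 1) ^ 2 = M + 1 := Real.sq_sqrt hpos
      have h5 : (√((M : ℝ) + 1 + 1))⁻¹ ≤ 2 * (√((M : ℝ) + 1 + 1) - √((M : ℝ) + 1)) := by
        rw [inv_le_iff_one_le_mul₀ h1]
        nlinarith
      linarith
    · simp
    · simp only [Finset.mem_insert, Finset.mem_Icc]
      push_cast
      omega

theorem freqWeight_le (v : ℤ × ℤ) :
    freqWeight v ≤ 2 * ((√(1 + |(v.1 : ℝ)|))⁻¹ * (√(1 + |(v.2 : ℝ)|))⁻¹) := by
  unfold freqWeight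
  rw [← mul_inv, ← Real.sqrt_mul (by positivity), ← div_eq_mul_inv, inv_eq_one_div,
    div_le_div_iff₀ (by positivity) (by positivity), one_mul]
  rw [show (2 : ℝ) = √4 by rw [show (4 : ℝ) = 2 ^ 2 by norm_num]; simp,
    ← Real.sqrt_mul (by norm_num)]
  apply Real.sqrt_le_sqrt
  nlinarith [sq_abs (v.1 : ℝ), sq_abs (v.2 : ℝ), sq_nonneg (|(v.1 : ℝ)| - |(v.2 : ℝ)|),
    sq_nonneg (|(v.1 : ℝ)| - 1), sq_nonneg (|(v.2 : ℝ)| - 1)]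

theorem sum_freqWeight_box_le (M : ℕ) :
    ∑ v ∈ Finset.Icc (-(M : ℤ)) M ×ˢ Finset.Icc (-(M : ℤ)) M, freqWeight v ≤ 32 * (M + 1) := by
  calc _ ≤ ∑ v ∈ Finset.Icc (-(M : ℤ)) M ×ˢ Finset.Icc (-(M : ℤ)) M,
        2 * ((√(1 + |(v.1 : ℝ)|))⁻¹ * (√(1 + |(v.2 : ℝ)|))⁻¹) :=
        Finset.sum_le_sum fun v _ => freqWeight_le v
    _ = 2 * ((∑ a ∈ Finset.Icc (-(M : ℤ)) M, (√(1 + |(a : ℝ)|))⁻¹) *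
        ∑ a ∈ Finset.Icc (-(M : ℤ)) M, (√(1 + |(a : ℝ)|))⁻¹) := by
        rw [Finset.sum_mul_sum, Finset.sum_product, Finset.mul_sum]
        simp_rw [Finset.mul_sum]
    _ ≤ 2 * ((4 * √(M + 1)) * (4 * √(M + 1))) := by
        have := sum_inv_sqrt_le M
        have h0 : 0 ≤ ∑ a ∈ Finset.Icc (-(M : ℤ)) M, (√(1 + |(a : ℝ)|))⁻¹ :=
          Finset.sum_nonneg fun a _ => by positivity
        gcongr
    _ = 32 * (√(M + 1) * √(M + 1)) := by ring
    _ = 32 * (M + 1) := by rw [Real.mul_self_sqrt (by positivity)]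

theorem circumradius_identity {a b c d e f m : ℤ} (h1 : a ^ 2 + b ^ 2 = m)
    (h2 : c ^ 2 + d ^ 2 = m) (h3 : e ^ 2 + f ^ 2 = m) :
    ((c - a) * (f - b) - (d - b) * (e - a)) ^ 2 * (4 * m) =
      ((a - c) ^ 2 + (b - d) ^ 2) * ((c - e) ^ 2 + (d - f) ^ 2) *
        ((e - a) ^ 2 + (f - b) ^ 2) := by
  grind

theorem sq_dist_pos {a b : ℤ × ℤ} (h : a ≠ b) : 0 < (a.1 - b.1) ^ 2 + (a.2 - b.2) ^ 2 := by
  by_contra hc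
  apply h
  have h1 := sq_nonneg (a.1 - b.1)
  have h2 := sq_nonneg (a.2 - b.2)
  have h3 : a.1 - b.1 = 0 := by
    rw [← sq_eq_zero_iff]; omega
  have h4 : a.2 - b.2 = 0 := by
    rw [← sq_eq_zero_iff]; omega
  ext <;> omega

/-- Three lattice points on a circle of radius `√m` cannot all be close to a given point. -/
theorem not_three_close {m : ℕ} {a b c w : ℤ × ℤ} {t : ℤ} (ha : a ∈ latticeSet m)
    (hb : b ∈ latticeSet m) (hc : c ∈ latticeSet m) (hab : a ≠ b) (hbc : b ≠ c) (hca : c ≠ a)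
    (hta : (w.1 + a.1) ^ 2 + (w.2 + a.2) ^ 2 ≤ t) (htb : (w.1 + b.1) ^ 2 + (w.2 + b.2) ^ 2 ≤ t)
    (htc : (w.1 + c.1) ^ 2 + (w.2 + c.2) ^ 2 ≤ t) (ht : 16 * t ^ 3 < m) : False := by
  rw [mem_latticeSet_s16] at ha hb hc
  have hid := circumradius_identity ha hb hc
  have p1 := sq_dist_pos hab
  have p2 := sq_dist_pos hbc
  have p3 := sq_dist_pos hca
  have dist_le : ∀ x y : ℤ × ℤ, (w.1 + x.1) ^ 2 + (w.2 + x.2) ^ 2 ≤ t →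
      (w.1 + y.1) ^ 2 + (w.2 + y.2) ^ 2 ≤ t →
      (x.1 - y.1) ^ 2 + (x.2 - y.2) ^ 2 ≤ 4 * t := by
    intro x y hx hy
    linarith [sq_nonneg (2 * w.1 + x.1 + y.1), sq_nonneg (2 * w.2 + x.2 + y.2)]
  have q1 := dist_le a b hta htb
  have q2 := dist_le b c htb htc
  have q3 := dist_le c a htc hta
  have hle : ((a.1 - b.1) ^ 2 + (a.2 - b.2) ^ 2) * ((b.1 - c.1) ^ 2 + (b.2 - c.2) ^ 2) *
      ((c.1 - a.1) ^ 2 + (c.2 - a.2) ^ 2) ≤ (4 * t) * (4 * t) * (4 * t) := by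
    gcongr
    · exact mul_self_nonneg _
    · exact p1.le.trans q1
  have hpos := mul_pos (mul_pos p1 p2) p3
  rw [← hid] at hle hpos
  have hm : (0 : ℤ) ≤ m := Int.natCast_nonneg m
  set D := (b.1 - a.1) * (c.2 - a.2) - (b.2 - a.2) * (c.1 - a.1)
  have hD : 1 ≤ D ^ 2 := by
    by_contra h
    have : D ^ 2 = 0 := by have := sq_nonneg D; omega
    rw [this] at hpos
    omega
  have h4 : 4 * (m : ℤ) ≤ D ^ 2 * (4 * m) := le_mul_of_one_le_left (by omega) hD
  linarith

/-- A nonzero vector is a sum of two points of the circle in at most one way, up to order. -/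
theorem eq_or_eq_sub_of_sum {m : ℕ} {w a b : ℤ × ℤ} (hw : w ≠ 0) (ha : a ∈ latticeSet m)
    (ha' : w - a ∈ latticeSet m) (hb : b ∈ latticeSet m) (hb' : w - b ∈ latticeSet m) :
    a = b ∨ a = w - b := by
  rw [mem_latticeSet_s16] at ha ha' hb hb'
  rw [Prod.fst_sub, Prod.snd_sub] at ha' hb'
  by_cases hab : a = b
  · exact Or.inl hab
  right
  by_contra hne
  have p1 := sq_dist_pos hab
  have p2 := sq_dist_pos hne
  have p3 := sq_dist_pos hw
  rw [Prod.fst_sub, Prod.snd_sub] at p2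
  rw [Prod.fst_zero, Prod.snd_zero, sub_zero, sub_zero] at p3
  obtain ⟨a1, a2⟩ := a
  obtain ⟨b1, b2⟩ := b
  obtain ⟨w1, w2⟩ := w
  simp only at *
  have hwd : w1 * (a1 - b1) + w2 * (a2 - b2) = 0 := by linarith
  have hxd : (a1 + b1 - w1) * (a1 - b1) + (a2 + b2 - w2) * (a2 - b2) = 0 := by linarith
  have hxw : (a1 + b1 - w1) * w1 + (a2 + b2 - w2) * w2 = 0 := by linarith
  have hx : a1 - (w1 - b1) = a1 + b1 - w1 := by ring
  have hy : a2 - (w2 - b2) = a2 + b2 - w2 := by ring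
  rw [hx, hy] at p2
  generalize a1 + b1 - w1 = x at *
  generalize a2 + b2 - w2 = y at *
  generalize a1 - b1 = r at *
  generalize a2 - b2 = s at *
  have c1 : (x * w2 - y * w1) * r = 0 := by linear_combination w2 * hxd - y * hwd
  have c2 : (x * w2 - y * w1) * s = 0 := by linear_combination x * hwd - w1 * hxd
  have c3 : (x * w2 - y * w1) ^ 2 * (r ^ 2 + s ^ 2) = 0 := by
    linear_combination (x * w2 - y * w1) * (r * c1 + s * c2)
  have c4 : (x * w2 - y * w1) ^ 2 = (x ^ 2 + y ^ 2) * (w1 ^ 2 + w2 ^ 2) := by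
    linear_combination (-(x * w1 + y * w2)) * hxw
  rw [c4] at c3
  have := mul_pos (mul_pos p2 p3) p1
  omega

/-- Pairs of lattice points on the circle. -/
def latticePairs (m : ℕ) : Finset ((ℤ × ℤ) × (ℤ × ℤ)) := latticeSet m ×ˢ latticeSet m

/-- Quadruples of lattice points on the circle. -/
def latticeQuads (m : ℕ) : Finset (((ℤ × ℤ) × (ℤ × ℤ)) × ((ℤ × ℤ) × (ℤ × ℤ))) :=
  latticePairs m ×ˢ latticePairs m

/-- The sum of the four entries of a quadruple. -/
def quadSum (x : ((ℤ × ℤ) × (ℤ × ℤ)) × ((ℤ × ℤ) × (ℤ × ℤ))) : ℤ × ℤ :=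
  x.1.1 + x.1.2 + (x.2.1 + x.2.2)

theorem card_latticePairs (m : ℕ) : (latticePairs m).card = latN m ^ 2 := by
  rw [latticePairs, Finset.card_product, latN, sq]

theorem card_latticeQuads (m : ℕ) : (latticeQuads m).card = latN m ^ 4 := by
  rw [latticeQuads, Finset.card_product, card_latticePairs]; ring

theorem card_pairs_sum_le (m : ℕ) (w : ℤ × ℤ) :
    ((latticePairs m).filter (fun p => p.1 + p.2 = w)).card ≤ latN m := by
  unfold latN
  refine Finset.card_le_card_of_injOn (fun p => p.1) ?_ ?_
  · intro p hp
    simp only [latticePairs, Finset.coe_filter, Set.mem_ofPred_eq, Finset.mem_product] at hp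
    exact hp.1.1
  · intro p hp q hq hpq
    simp only [Finset.coe_filter, Set.mem_ofPred_eq] at hp hq
    refine Prod.ext hpq ?_
    have h := hp.2.trans hq.2.symm
    simp only at hpq
    rw [hpq] at h
    exact add_left_cancel h

theorem card_pairs_sum_le_two (m : ℕ) {w : ℤ × ℤ} (hw : w ≠ 0) :
    ((latticePairs m).filter (fun p => p.1 + p.2 = w)).card ≤ 2 := by
  rcases Finset.eq_empty_or_nonempty
    ((latticePairs m).filter (fun p => p.1 + p.2 = w)) with h0 | ⟨q, hq⟩
  · rw [h0]; simp
  have aux : ∀ p ∈ (latticePairs m).filter (fun p => p.1 + p.2 = w),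
      p.1 ∈ latticeSet m ∧ w - p.1 ∈ latticeSet m ∧ p = (p.1, w - p.1) := by
    intro p hp
    rw [Finset.mem_filter, latticePairs, Finset.mem_product] at hp
    have : p.2 = w - p.1 := by rw [← hp.2]; abel
    exact ⟨hp.1.1, this ▸ hp.1.2, Prod.ext rfl this⟩
  obtain ⟨hq1, hq2, -⟩ := aux q hq
  refine (Finset.card_le_card (t := {(q.1, w - q.1), (w - q.1, q.1)}) ?_).trans
    Finset.card_le_two
  intro p hp
  obtain ⟨hp1, hp2, hp3⟩ := aux p hp
  rw [hp3, Finset.mem_insert, Finset.mem_singleton]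
  rcases eq_or_eq_sub_of_sum hw hp1 hp2 hq1 hq2 with h | h
  · left; rw [h]
  · right; rw [h, sub_sub_cancel]

theorem card_quads_sum_le (m : ℕ) (v : ℤ × ℤ) :
    ((latticeQuads m).filter (fun x => quadSum x = v)).card ≤ 3 * latN m ^ 2 := by
  have h1 : ((latticeQuads m).filter (fun x => quadSum x = v)).card =
      ∑ p ∈ latticePairs m,
        ((latticePairs m).filter (fun q => q.1 + q.2 = v - (p.1 + p.2))).card := by
    rw [Finset.card_filter, latticeQuads, Finset.sum_product]
    refine Finset.sum_congr rfl fun p _ => ?_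
    rw [Finset.card_filter]
    refine Finset.sum_congr rfl fun q _ => ?_
    refine if_congr ?_ rfl rfl
    rw [quadSum, eq_sub_iff_add_eq']
  rw [h1]
  calc _ ≤ ∑ p ∈ latticePairs m, (2 + if p.1 + p.2 = v then latN m else 0) := by
        refine Finset.sum_le_sum fun p _ => ?_
        split_ifs with h
        · exact (card_pairs_sum_le m _).trans (by omega)
        · exact card_pairs_sum_le_two m (sub_ne_zero.2 fun h' => h h'.symm)
    _ = 2 * latN m ^ 2 + ((latticePairs m).filter (fun p => p.1 + p.2 = v)).card * latN m := by
        rw [Finset.sum_add_distrib, Finset.sum_const, card_latticePairs, ← Finset.sum_filter,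
          Finset.sum_const, smul_eq_mul, smul_eq_mul]
        ring
    _ ≤ 2 * latN m ^ 2 + latN m * latN m := by
        gcongr
        exact card_pairs_sum_le m v
    _ = _ := by ring

theorem card_quads_close_le (m : ℕ) :
    ((latticeQuads m).filter
      (fun x => 16 * ((quadSum x).1 ^ 2 + (quadSum x).2 ^ 2) ^ 3 < (m : ℤ))).card
      ≤ 2 * latN m ^ 3 := by
  set S := (latticeQuads m).filter
      (fun x => 16 * ((quadSum x).1 ^ 2 + (quadSum x).2 ^ 2) ^ 3 < (m : ℤ)) with hS
  have himg : (S.image (fun x => (x.1, x.2.1))).card ≤ latN m ^ 3 := by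
    have : latN m ^ 3 = (latticePairs m ×ˢ latticeSet m).card := by
      rw [Finset.card_product, card_latticePairs, latN]; ring
    rw [this]
    apply Finset.card_le_card
    intro y hy
    obtain ⟨x, hx, rfl⟩ := Finset.mem_image.1 hy
    rw [hS, Finset.mem_filter, latticeQuads, Finset.mem_product, latticePairs,
      Finset.mem_product, Finset.mem_product] at hx
    rw [Finset.mem_product, latticePairs, Finset.mem_product]
    exact ⟨hx.1.1, hx.1.2.1⟩
  refine (Finset.card_le_mul_card_image (f := fun x => (x.1, x.2.1)) S 2 ?_).trans
    (Nat.mul_le_mul_left 2 himg)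
  intro y _
  by_contra hcard
  rw [not_le, Finset.two_lt_card] at hcard
  obtain ⟨a, ha, b, hb, c, hc, hab, hac, hbc⟩ := hcard
  have aux : ∀ x ∈ S.filter (fun x => (x.1, x.2.1) = y), x.2.2 ∈ latticeSet m ∧
      16 * (((y.1.1 + y.1.2 + y.2).1 + x.2.2.1) ^ 2 +
        ((y.1.1 + y.1.2 + y.2).2 + x.2.2.2) ^ 2) ^ 3 < (m : ℤ) ∧ x = (y.1, (y.2, x.2.2)) := by
    intro x hx
    rw [Finset.mem_filter, hS, Finset.mem_filter, latticeQuads, Finset.mem_product, latticePairs,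
      Finset.mem_product, Finset.mem_product] at hx
    obtain ⟨⟨hx1, hx2⟩, rfl⟩ := hx
    refine ⟨hx1.2.2, ?_, rfl⟩
    simpa only [quadSum, ← add_assoc, Prod.fst_add, Prod.snd_add] using hx2
  obtain ⟨ha1, ha2, ha3⟩ := aux a ha
  obtain ⟨hb1, hb2, hb3⟩ := aux b hb
  obtain ⟨hc1, hc2, hc3⟩ := aux c hc
  have hne : ∀ x z : ((ℤ × ℤ) × (ℤ × ℤ)) × ((ℤ × ℤ) × (ℤ × ℤ)), x = (y.1, (y.2, x.2.2)) → z = (y.1, (y.2, z.2.2)) → x ≠ z →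
      x.2.2 ≠ z.2.2 := by
    intro x z hx hz hxz h
    apply hxz
    rw [hx, hz, h]
  generalize y.1.1 + y.1.2 + y.2 = w at *
  set na := (w.1 + a.2.2.1) ^ 2 + (w.2 + a.2.2.2) ^ 2
  set nb := (w.1 + b.2.2.1) ^ 2 + (w.2 + b.2.2.2) ^ 2
  set nc := (w.1 + c.2.2.1) ^ 2 + (w.2 + c.2.2.2) ^ 2
  have ht : 16 * (max na (max nb nc)) ^ 3 < (m : ℤ) := by
    rcases max_choice na (max nb nc) with h | h
    · rw [h]; exact ha2
    · rw [h]
      rcases max_choice nb nc with h' | h'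
      · rw [h']; exact hb2
      · rw [h']; exact hc2
  exact not_three_close (w := w) ha1 hb1 hc1 (hne a b ha3 hb3 hab) (hne b c hb3 hc3 hbc)
    (hne c a hc3 ha3 hac.symm) (le_max_left _ _)
    ((le_max_left _ _).trans (le_max_right _ _)) ((le_max_right _ _).trans (le_max_right _ _)) ht

theorem sum_small_freqWeight_le {m : ℕ} (hN : 0 < latN m) :
    ∑ x ∈ (latticeQuads m).filter
      (fun x => (quadSum x).1 ^ 2 + (quadSum x).2 ^ 2 ≤ (latN m : ℤ)), freqWeight (quadSum x)
      ≤ 192 * ((latN m : ℝ) ^ 2 * √(latN m)) := by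
  set M := Nat.sqrt (latN m) with hM
  set B := Finset.Icc (-(M : ℤ)) M ×ˢ Finset.Icc (-(M : ℤ)) M
  have habs : ∀ z : ℤ, z ^ 2 ≤ (latN m : ℤ) → -(M : ℤ) ≤ z ∧ z ≤ M := by
    intro z hz
    have h1 : z.natAbs ≤ M := by
      rw [hM, Nat.le_sqrt']
      have : ((z.natAbs ^ 2 : ℕ) : ℤ) ≤ (latN m : ℤ) := by
        rw [Nat.cast_pow, Int.natAbs_sq]; exact hz
      exact_mod_cast this
    omega
  rw [← Finset.sum_fiberwise_of_maps_to (g := quadSum) (t := B)]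
  swap
  · intro x hx
    rw [Finset.mem_filter] at hx
    rw [Finset.mem_product, Finset.mem_Icc, Finset.mem_Icc]
    exact ⟨habs _ (by nlinarith [sq_nonneg (quadSum x).2]),
      habs _ (by nlinarith [sq_nonneg (quadSum x).1])⟩
  have h1s : 1 ≤ √(latN m : ℝ) := by
    rw [Real.one_le_sqrt]; exact_mod_cast hN
  have hMs : (M : ℝ) ≤ √(latN m : ℝ) := Real.nat_sqrt_le_real_sqrt
  calc _ ≤ ∑ v ∈ B, (3 * (latN m : ℝ) ^ 2) * freqWeight v := by
        refine Finset.sum_le_sum fun v _ => ?_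
        rw [Finset.sum_congr rfl (g := fun _ => freqWeight v), Finset.sum_const, nsmul_eq_mul]
        · refine mul_le_mul_of_nonneg_right ?_ (freqWeight_nonneg v)
          have h2 : (((latticeQuads m).filter (fun x => (quadSum x).1 ^ 2 + (quadSum x).2 ^ 2
              ≤ (latN m : ℤ))).filter (fun x => quadSum x = v)).card ≤ 3 * latN m ^ 2 :=
            (Finset.card_le_card
              (Finset.filter_subset_filter _ (Finset.filter_subset _ _))).trans
              (card_quads_sum_le m v)
          exact_mod_cast h2
        · intro x hx
          rw [(Finset.mem_filter.1 hx).2]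
    _ = 3 * (latN m : ℝ) ^ 2 * ∑ v ∈ B, freqWeight v := by rw [Finset.mul_sum]
    _ ≤ 3 * (latN m : ℝ) ^ 2 * (32 * (M + 1)) := by
        gcongr
        exact sum_freqWeight_box_le M
    _ ≤ 3 * (latN m : ℝ) ^ 2 * (32 * (√(latN m) + √(latN m))) := by gcongr
    _ = _ := by ring

/-- The main combinatorial estimate. -/
theorem exists_sum_freqWeight_le : ∃ C : ℝ, 0 < C ∧ ∀ m : ℕ, 0 < m → 0 < latN m →
    ∑ x ∈ latticeQuads m, freqWeight (quadSum x) ≤ C * ((latN m : ℝ) ^ 2 * √(latN m)) := by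
  obtain ⟨C, hC1, hC⟩ := exists_latN_pow_le
  refine ⟨192 + 2 + 16 * C, by positivity, fun m hm hN => ?_⟩
  set s := √(latN m : ℝ) with hs
  have hs0 : 0 < s := Real.sqrt_pos.2 (by exact_mod_cast hN)
  have hsN : s ^ 2 = latN m := Real.sq_sqrt (Nat.cast_nonneg _)
  have hsmall := sum_small_freqWeight_le hN
  have hclose : ((((latticeQuads m).filter
      (fun x => 16 * ((quadSum x).1 ^ 2 + (quadSum x).2 ^ 2) ^ 3 < (m : ℤ))).card : ℕ) : ℝ)
      ≤ 2 * (latN m : ℝ) ^ 3 := by exact_mod_cast card_quads_close_le m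
  have hpt : ∀ x ∈ latticeQuads m, freqWeight (quadSum x) ≤
      ((if (quadSum x).1 ^ 2 + (quadSum x).2 ^ 2 ≤ (latN m : ℤ) then freqWeight (quadSum x)
        else 0) +
      (if 16 * ((quadSum x).1 ^ 2 + (quadSum x).2 ^ 2) ^ 3 < (m : ℤ) then s⁻¹ else 0)) +
      16 * C * (s ^ 3)⁻¹ := by
    intro x _
    generalize quadSum x = v
    have hw := freqWeight_nonneg v
    have hlast : 0 ≤ 16 * C * (s ^ 3)⁻¹ := by positivity
    have hmid : 0 ≤ (if 16 * (v.1 ^ 2 + v.2 ^ 2) ^ 3 < (m : ℤ) then s⁻¹ else 0) := by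
      split_ifs <;> positivity
    by_cases h1 : v.1 ^ 2 + v.2 ^ 2 ≤ (latN m : ℤ)
    · rw [if_pos h1]; linarith
    rw [if_neg h1]
    by_cases h2 : 16 * (v.1 ^ 2 + v.2 ^ 2) ^ 3 < (m : ℤ)
    · rw [if_pos h2]
      have : freqWeight v ≤ s⁻¹ := by
        unfold freqWeight
        gcongr
        apply Real.sqrt_le_sqrt
        have h3 : ((latN m : ℤ) : ℝ) ≤ ((v.1 ^ 2 + v.2 ^ 2 : ℤ) : ℝ) := by
          exact_mod_cast (not_le.1 h1).le
        push_cast at h3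
        linarith
      linarith
    · rw [if_neg h2]
      have h3 : (m : ℝ) ≤ 16 * ((v.1 : ℝ) ^ 2 + (v.2 : ℝ) ^ 2) ^ 3 := by
        exact_mod_cast not_lt.1 h2
      set q := 1 + (v.1 : ℝ) ^ 2 + (v.2 : ℝ) ^ 2 with hq
      have hqpos : 0 < q := by positivity
      have h4 : (m : ℝ) ≤ 16 * q ^ 3 := h3.trans (by gcongr; linarith)
      have h5 : s ^ 3 ≤ 16 * C * √q := by
        rw [← pow_le_pow_iff_left₀ (by positivity) (by positivity) (n := 6) (by norm_num)]
        calc (s ^ 3) ^ 6 = (s ^ 2) ^ 9 := by ring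
          _ = (latN m : ℝ) ^ 9 := by rw [hsN]
          _ ≤ C * m := hC m hm
          _ ≤ C * (16 * q ^ 3) := by gcongr
          _ = (16 * C) * q ^ 3 := by ring
          _ ≤ (16 * C) ^ 6 * q ^ 3 := by
            gcongr
            exact le_self_pow₀ (by linarith) (by norm_num)
          _ = (16 * C) ^ 6 * (√q ^ 2) ^ 3 := by rw [Real.sq_sqrt hqpos.le]
          _ = _ := by ring
      have h6 : freqWeight v ≤ 16 * C * (s ^ 3)⁻¹ := by
        unfold freqWeight
        rw [← hq, ← div_eq_mul_inv, inv_eq_one_div, div_le_div_iff₀ (by positivity) (by positivity),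
          one_mul]
        exact h5
      linarith
  refine (Finset.sum_le_sum hpt).trans ?_
  rw [Finset.sum_add_distrib, Finset.sum_add_distrib, ← Finset.sum_filter, ← Finset.sum_filter,
    Finset.sum_const, Finset.sum_const, nsmul_eq_mul, nsmul_eq_mul, card_latticeQuads]
  have e1 : 2 * (latN m : ℝ) ^ 3 * s⁻¹ = 2 * ((latN m : ℝ) ^ 2 * s) := by
    rw [← hsN]; field_simp
  have e2 : ((latN m ^ 4 : ℕ) : ℝ) * (16 * C * (s ^ 3)⁻¹) =
      16 * C * ((latN m : ℝ) ^ 2 * s) := by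
    push_cast
    rw [← hsN]; field_simp
  have e3 := mul_le_mul_of_nonneg_right hclose (inv_nonneg.2 hs0.le)
  rw [e1] at e3
  rw [e2]
  linarith

/-- A Sturm-type estimate: if `(s, q)` rotates with angular speed `κ` bounded away from zero on a
circle of radius `R²`, then `s` spends little time near zero. -/
theorem exists_integral_inv_sq_add_le {L : ℝ} (hL : 0 < L) {κ κ' : ℝ → ℝ} {κ₀ B : ℝ}
    (hκ : ∀ t, HasDerivAt κ (κ' t) t) (hκ' : Continuous κ') (hκ₀ : 0 < κ₀)
    (hlow : ∀ t ∈ Set.Icc 0 L, κ₀ ≤ |κ t|) (hB : ∀ t ∈ Set.Icc 0 L, |κ' t| ≤ B) :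
    ∃ C : ℝ, 0 < C ∧ ∀ (R : ℝ) (s q : ℝ → ℝ), 1 ≤ R → Continuous s → Continuous q →
      (∀ t ∈ Set.Icc 0 L, HasDerivAt s (-(κ t * q t)) t) →
      (∀ t ∈ Set.Icc 0 L, HasDerivAt q (κ t * s t) t) →
      (∀ t ∈ Set.Icc 0 L, s t ^ 2 + q t ^ 2 = R ^ 4) →
      ∫ t in (0 : ℝ)..L, R ^ 2 / (s t ^ 2 + R ^ 2) ≤ C / R := by
  have hB0 : 0 ≤ B := (abs_nonneg _).trans (hB 0 ⟨le_rfl, hL.le⟩)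
  refine ⟨4 / κ₀ + L + 2 * (1 + B / κ₀ ^ 2) * L, by positivity, ?_⟩
  intro R s q hR hs hq hs' hq' hsq
  have hR0 : 0 < R := by linarith
  have hIcc : Set.uIcc 0 L = Set.Icc 0 L := Set.uIcc_of_le hL.le
  have hκne : ∀ t ∈ Set.Icc 0 L, κ t ≠ 0 := fun t ht h => by
    have := hlow t ht
    rw [h, abs_zero] at this
    linarith
  have hκc : Continuous κ := continuous_iff_continuousAt.2 fun t => (hκ t).continuousAt
  have hs_le : ∀ t ∈ Set.Icc 0 L, |s t| ≤ R ^ 2 := fun t ht =>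
    abs_le_of_sq_le_sq (by nlinarith [hsq t ht, sq_nonneg (q t)]) (by positivity)
  have hq_le : ∀ t ∈ Set.Icc 0 L, |q t| ≤ R ^ 2 := fun t ht =>
    abs_le_of_sq_le_sq (by nlinarith [hsq t ht, sq_nonneg (s t)]) (by positivity)
  have harc : ∀ u : ℝ, |Real.arctan u| ≤ 2 := fun u => by
    rw [abs_le]
    have := Real.pi_le_four
    constructor <;> linarith [Real.neg_pi_div_two_lt_arctan u, Real.arctan_lt_pi_div_two u]
  have hden : ∀ t, 0 < s t ^ 2 + R ^ 2 := fun t => by positivity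
  set E : ℝ → ℝ := fun t => Real.arctan (s t / R) * (s t - q t * κ' t / κ t ^ 2) with hE
  set G : ℝ → ℝ := fun t => Real.arctan (s t / R) * (q t / κ t) with hG
  have hGd : ∀ t ∈ Set.uIcc 0 L,
      HasDerivAt G (R + E t - R * (R ^ 2 + 1) * (R ^ 2 / (s t ^ 2 + R ^ 2))) t := by
    intro t ht
    rw [hIcc] at ht
    have h0 := hκne t ht
    have h := ((hs' t ht).div_const R).arctan.mul ((hq' t ht).div (hκ t) h0)
    refine h.congr_deriv ?_
    have h1 := (hden t).ne'
    have h2 : 1 + (s t / R) ^ 2 ≠ 0 := by positivity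
    have h3 : R ^ 2 + s t ^ 2 ≠ 0 := by positivity
    have h4 : q t ^ 2 = R ^ 4 - s t ^ 2 := by linarith [hsq t ht]
    have h5 : 1 / (1 + (s t / R) ^ 2) * (-(κ t * q t) / R) * (q t / κ t) =
        R - R * (R ^ 2 + 1) * (R ^ 2 / (s t ^ 2 + R ^ 2)) := by
      have : 1 / (1 + (s t / R) ^ 2) * (-(κ t * q t) / R) * (q t / κ t) =
        - (R * q t ^ 2) / (s t ^ 2 + R ^ 2) := by
        field_simp
        ring
      rw [this, h4]
      field_simp
      ring
    have h6 : (κ t * s t * κ t - q t * κ' t) / κ t ^ 2 = s t - q t * κ' t / κ t ^ 2 := by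
      field_simp
    rw [Pi.div_apply, h5, h6]
    simp only [hE]
    ring
  have hEc : ContinuousOn E (Set.uIcc 0 L) := by
    rw [hIcc]
    refine ContinuousOn.mul (Real.continuous_arctan.comp (hs.div_const R)).continuousOn ?_
    exact hs.continuousOn.sub ((hq.mul hκ').continuousOn.div (hκc.pow 2).continuousOn
      fun t ht => pow_ne_zero 2 (hκne t ht))
  have hIc : Continuous fun t => R ^ 2 / (s t ^ 2 + R ^ 2) :=
    continuous_const.div ((hs.pow 2).add continuous_const) fun t => (hden t).ne'
  have hEi : IntervalIntegrable E volume 0 L := hEc.intervalIntegrable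
  have hIi : IntervalIntegrable (fun t => R ^ 2 / (s t ^ 2 + R ^ 2)) volume 0 L :=
    hIc.intervalIntegrable _ _
  have hRE : IntervalIntegrable (fun t => R + E t) volume 0 L :=
    intervalIntegrable_const.add hEi
  have hFTC := intervalIntegral.integral_eq_sub_of_hasDerivAt hGd (hRE.sub (hIi.const_mul _))
  rw [intervalIntegral.integral_sub hRE (hIi.const_mul _),
    intervalIntegral.integral_add intervalIntegrable_const hEi,
    intervalIntegral.integral_const_mul, intervalIntegral.integral_const, sub_zero,
    smul_eq_mul] at hFTC
  have hE_le : ∀ t ∈ Set.Icc 0 L, |E t| ≤ 2 * (1 + B / κ₀ ^ 2) * R ^ 2 := by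
    intro t ht
    have h1 : |q t * κ' t / κ t ^ 2| ≤ R ^ 2 * B / κ₀ ^ 2 := by
      rw [abs_div, abs_mul, abs_pow]
      gcongr
      · exact hq_le t ht
      · exact hB t ht
      · exact hlow t ht
    calc |E t| = |Real.arctan (s t / R)| * |s t - q t * κ' t / κ t ^ 2| := abs_mul _ _
      _ ≤ 2 * (R ^ 2 + R ^ 2 * B / κ₀ ^ 2) := by
        gcongr
        · exact harc _
        · exact (abs_sub _ _).trans (add_le_add (hs_le t ht) h1)
      _ = _ := by ring
  have hEint : |∫ t in (0 : ℝ)..L, E t| ≤ 2 * (1 + B / κ₀ ^ 2) * R ^ 2 * L := by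
    have := intervalIntegral.norm_integral_le_of_norm_le_const (f := E) (a := 0) (b := L)
      (C := 2 * (1 + B / κ₀ ^ 2) * R ^ 2) fun t ht => by
        rw [Set.uIoc_of_le hL.le] at ht
        exact hE_le t ⟨ht.1.le, ht.2⟩
    rwa [sub_zero, abs_of_pos hL] at this
  have hG_le : ∀ t ∈ Set.Icc 0 L, |G t| ≤ 2 * (R ^ 2 / κ₀) := by
    intro t ht
    rw [hG, abs_mul, abs_div]
    gcongr
    · exact harc _
    · exact hq_le t ht
    · exact hlow t ht
  have hG0 := abs_le.1 (hG_le 0 ⟨le_rfl, hL.le⟩)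
  have hGL := abs_le.1 (hG_le L ⟨hL.le, le_rfl⟩)
  have hE2 := abs_le.1 hEint
  set J := ∫ t in (0 : ℝ)..L, R ^ 2 / (s t ^ 2 + R ^ 2)
  have hJ : R ^ 3 * J ≤ (4 / κ₀ + L + 2 * (1 + B / κ₀ ^ 2) * L) * R ^ 2 := by
    have hJ0 : 0 ≤ J := intervalIntegral.integral_nonneg hL.le fun t _ => by positivity
    have h1 : R * (R ^ 2 + 1) * J ≤ 4 * (R ^ 2 / κ₀) + L * R + 2 * (1 + B / κ₀ ^ 2) * R ^ 2 * L := by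
      linarith [hE2.2, hG0.2, hGL.1]
    have h2 : L * R ≤ L * R ^ 2 := by
      gcongr
      nlinarith
    have h3 : 0 ≤ R * J := by positivity
    calc R ^ 3 * J ≤ R * (R ^ 2 + 1) * J := by nlinarith
      _ ≤ 4 * (R ^ 2 / κ₀) + L * R ^ 2 + 2 * (1 + B / κ₀ ^ 2) * R ^ 2 * L := by linarith
      _ = _ := by ring
  rw [le_div_iff₀ hR0]
  have hR2 : 0 < R ^ 2 := by positivity
  refine le_of_mul_le_mul_right ?_ hR2
  linarith

/-- Van der Corput-type bound for a phase whose derivative `2πs` has a rotating companion `q`. -/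
theorem exists_norm_integral_le {L : ℝ} (hL : 0 < L) {κ κ' : ℝ → ℝ} {κ₀ B : ℝ}
    (hκ : ∀ t, HasDerivAt κ (κ' t) t) (hκ' : Continuous κ') (hκ₀ : 0 < κ₀)
    (hlow : ∀ t ∈ Set.Icc 0 L, κ₀ ≤ |κ t|) (hκB : ∀ t ∈ Set.Icc 0 L, |κ t| ≤ B)
    (hB : ∀ t ∈ Set.Icc 0 L, |κ' t| ≤ B) :
    ∃ C : ℝ, 0 < C ∧ ∀ (R : ℝ) (s q : ℝ → ℝ), 1 ≤ R → Continuous s → Continuous q →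
      (∀ t ∈ Set.Icc 0 L, HasDerivAt s (-(κ t * q t)) t) →
      (∀ t ∈ Set.Icc 0 L, HasDerivAt q (κ t * s t) t) →
      (∀ t ∈ Set.Icc 0 L, s t ^ 2 + q t ^ 2 = R ^ 4) →
      ∀ (e A A' : ℝ → ℂ) (K : ℝ), (∀ t, HasDerivAt e (2 * π * Complex.I * s t * e t) t) →
      (∀ t, ‖e t‖ = 1) → (∀ t, HasDerivAt A (A' t) t) → Continuous A' →
      (∀ t ∈ Set.Icc 0 L, ‖A t‖ ≤ K) → (∀ t ∈ Set.Icc 0 L, ‖A' t‖ ≤ K) →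
      ‖∫ t in (0 : ℝ)..L, A t * e t‖ ≤ C * K / R := by
  obtain ⟨C, hC, hJ⟩ := exists_integral_inv_sq_add_le hL hκ hκ' hκ₀ hlow hB
  have hB0 : 0 ≤ B := (abs_nonneg _).trans (hB 0 ⟨le_rfl, hL.le⟩)
  refine ⟨2 + L + (B + 1) * C, by positivity, ?_⟩
  intro R s q hR hs hq hs' hq' hsq e A A' K he he1 hA hA' hAK hAK'
  replace hJ := hJ R s q hR hs hq hs' hq' hsq
  have hR0 : 0 < R := by linarith
  have hK : 0 ≤ K := (norm_nonneg _).trans (hAK 0 ⟨le_rfl, hL.le⟩)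
  have hIcc : Set.uIcc 0 L = Set.Icc 0 L := Set.uIcc_of_le hL.le
  have hden : ∀ t, 0 < s t ^ 2 + R ^ 2 := fun t => by positivity
  have hκc : Continuous κ := continuous_iff_continuousAt.2 fun t => (hκ t).continuousAt
  have hec : Continuous e := continuous_iff_continuousAt.2 fun t => (he t).continuousAt
  have hAc : Continuous A := continuous_iff_continuousAt.2 fun t => (hA t).continuousAt
  have hq_le : ∀ t ∈ Set.Icc 0 L, |q t| ≤ R ^ 2 := fun t ht =>
    abs_le_of_sq_le_sq (by nlinarith [hsq t ht, sq_nonneg (s t)]) (by positivity)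
  set w : ℝ → ℝ := fun t => R ^ 2 / (s t ^ 2 + R ^ 2) with hw
  have hwc : Continuous w :=
    continuous_const.div ((hs.pow 2).add continuous_const) fun t => (hden t).ne'
  set h : ℝ → ℝ := fun t => s t / (s t ^ 2 + R ^ 2) with hh
  have hhc : Continuous h := hs.div ((hs.pow 2).add continuous_const) fun t => (hden t).ne'
  set h' : ℝ → ℝ := fun t => -(κ t * q t) * (R ^ 2 - s t ^ 2) / (s t ^ 2 + R ^ 2) ^ 2 with hh'
  have hhc' : Continuous h' := ((hκc.mul hq).neg.mul (continuous_const.sub (hs.pow 2))).div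
    (((hs.pow 2).add continuous_const).pow 2) fun t => pow_ne_zero 2 (hden t).ne'
  have hhd : ∀ t ∈ Set.Icc 0 L, HasDerivAt h (h' t) t := by
    intro t ht
    refine ((hs' t ht).div (((hs' t ht).pow 2).add_const (R ^ 2)) (hden t).ne').congr_deriv ?_
    simp only [hh']
    congr 1
    rw [Pi.pow_apply]
    push_cast
    ring
  have hh_le : ∀ t, |h t| ≤ 1 / R := by
    intro t
    rw [hh, abs_div, abs_of_pos (hden t), div_le_div_iff₀ (hden t) hR0]
    nlinarith [sq_nonneg (|s t| - R), sq_abs (s t), sq_nonneg (|s t|), sq_nonneg R]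
  have hh_le' : ∀ t ∈ Set.Icc 0 L, |h' t| ≤ B * w t := by
    intro t ht
    have h1 : |R ^ 2 - s t ^ 2| ≤ s t ^ 2 + R ^ 2 :=
      abs_le.2 ⟨by nlinarith [sq_nonneg R], by nlinarith [sq_nonneg (s t)]⟩
    calc |h' t| = |κ t| * |q t| * |R ^ 2 - s t ^ 2| / (s t ^ 2 + R ^ 2) ^ 2 := by
          rw [hh', abs_div, abs_mul, abs_neg, abs_mul, abs_of_pos (pow_pos (hden t) 2)]
      _ ≤ B * R ^ 2 * (s t ^ 2 + R ^ 2) / (s t ^ 2 + R ^ 2) ^ 2 := by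
          gcongr
          · exact hκB t ht
          · exact hq_le t ht
      _ = B * w t := by
          have := (hden t).ne'
          simp only [hw]
          field_simp
  set c : ℂ := (2 * π * Complex.I)⁻¹ with hc
  have hpi : (2 * π * Complex.I : ℂ) ≠ 0 := Complex.two_pi_I_ne_zero
  have hc_le : ‖c‖ ≤ 1 := by
    rw [hc, norm_inv]
    apply inv_le_one_of_one_le₀
    simp only [norm_mul, Complex.norm_I, Complex.norm_real, Real.norm_eq_abs, mul_one,
      abs_of_pos Real.pi_pos, Complex.norm_ofNat]
    linarith [Real.pi_gt_three]
  set P : ℝ → ℂ := fun t =>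
    c * (A' t * h t * e t + A t * h' t * e t) - A t * e t * w t with hP
  have hPc : Continuous P := by
    have hhC : Continuous fun t => (h t : ℂ) := Complex.continuous_ofReal.comp hhc
    have hhC' : Continuous fun t => (h' t : ℂ) := Complex.continuous_ofReal.comp hhc'
    have hwC : Continuous fun t => (w t : ℂ) := Complex.continuous_ofReal.comp hwc
    exact (continuous_const.mul (((hA'.mul hhC).mul hec).add ((hAc.mul hhC').mul hec))).sub
      ((hAc.mul hec).mul hwC)
  have hHd : ∀ t ∈ Set.uIcc 0 L,
      HasDerivAt (fun t => c * (A t * h t * e t)) (A t * e t + P t) t := by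
    intro t ht
    rw [hIcc] at ht
    have h1 := (((hA t).mul (hhd t ht).ofReal_comp).mul (he t)).const_mul c
    refine h1.congr_deriv ?_
    have h2 : (s t : ℂ) * h t = 1 - w t := by
      have h3 : s t * h t = 1 - w t := by
        have := (hden t).ne'
        simp only [hh, hw]
        field_simp
        ring
      exact_mod_cast congrArg (fun u : ℝ => (u : ℂ)) h3
    have h4 : c * (2 * π * Complex.I) = 1 := inv_mul_cancel₀ hpi
    simp only [hP, Pi.mul_apply]
    linear_combination (A t * e t * (s t * h t)) * h4 + A t * e t * h2
  have hAei : IntervalIntegrable (fun t => A t * e t) volume 0 L :=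
    (hAc.mul hec).intervalIntegrable _ _
  have hPi : IntervalIntegrable P volume 0 L := hPc.intervalIntegrable _ _
  have hFTC := intervalIntegral.integral_eq_sub_of_hasDerivAt hHd (hAei.add hPi)
  rw [intervalIntegral.integral_add hAei hPi] at hFTC
  have hbd : ∀ t ∈ Set.Icc 0 L, ‖c * (A t * h t * e t)‖ ≤ K / R := by
    intro t ht
    rw [norm_mul, norm_mul, norm_mul, he1, mul_one, Complex.norm_real, Real.norm_eq_abs]
    calc ‖c‖ * (‖A t‖ * |h t|) ≤ 1 * (K * (1 / R)) := by
          gcongr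
          · exact hAK t ht
          · exact hh_le t
      _ = K / R := by ring
  have hP_le : ∀ t ∈ Set.Icc 0 L, ‖P t‖ ≤ K / R + K * (B + 1) * w t := by
    intro t ht
    have hw0 : 0 ≤ w t := by simp only [hw]; positivity
    have n1 : ‖A' t * h t * e t‖ ≤ K * (1 / R) := by
      rw [norm_mul, norm_mul, he1, mul_one, Complex.norm_real, Real.norm_eq_abs]
      gcongr
      · exact hAK' t ht
      · exact hh_le t
    have n2 : ‖A t * h' t * e t‖ ≤ K * (B * w t) := by
      rw [norm_mul, norm_mul, he1, mul_one, Complex.norm_real, Real.norm_eq_abs]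
      gcongr
      · exact hAK t ht
      · exact hh_le' t ht
    have n3 : ‖A t * e t * w t‖ ≤ K * w t := by
      rw [norm_mul, norm_mul, he1, mul_one, Complex.norm_real, Real.norm_eq_abs, abs_of_nonneg hw0]
      gcongr
      exact hAK t ht
    calc ‖P t‖ ≤ ‖c‖ * ‖A' t * h t * e t + A t * h' t * e t‖ + ‖A t * e t * w t‖ := by
          rw [← norm_mul]
          exact norm_sub_le _ _
      _ ≤ 1 * (K * (1 / R) + K * (B * w t)) + K * w t := by
          gcongr
          exact (norm_add_le _ _).trans (add_le_add n1 n2)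
      _ = _ := by ring
  have hPint : ‖∫ t in (0 : ℝ)..L, P t‖ ≤ L * (K / R) + K * (B + 1) * (C / R) := by
    have hwi : IntervalIntegrable w volume 0 L := hwc.intervalIntegrable _ _
    calc ‖∫ t in (0 : ℝ)..L, P t‖ ≤ ∫ t in (0 : ℝ)..L, ‖P t‖ :=
          intervalIntegral.norm_integral_le_integral_norm hL.le
      _ ≤ ∫ t in (0 : ℝ)..L, (K / R + K * (B + 1) * w t) :=
          intervalIntegral.integral_mono_on hL.le hPi.norm
            (intervalIntegrable_const.add (hwi.const_mul _)) hP_le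
      _ = L * (K / R) + K * (B + 1) * ∫ t in (0 : ℝ)..L, w t := by
          rw [intervalIntegral.integral_add intervalIntegrable_const (hwi.const_mul _),
            intervalIntegral.integral_const_mul, intervalIntegral.integral_const, sub_zero,
            smul_eq_mul]
      _ ≤ _ := by gcongr
  have hfinal : (∫ t in (0 : ℝ)..L, A t * e t) = c * (A L * h L * e L) - c * (A 0 * h 0 * e 0) -
      ∫ t in (0 : ℝ)..L, P t := by
    rw [← hFTC]
    ring
  rw [hfinal]
  calc _ ≤ ‖c * (A L * h L * e L)‖ + ‖c * (A 0 * h 0 * e 0)‖ + ‖∫ t in (0 : ℝ)..L, P t‖ :=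
        (norm_sub_le _ _).trans (add_le_add_left (norm_sub_le _ _) _)
    _ ≤ K / R + K / R + (L * (K / R) + K * (B + 1) * (C / R)) :=
        add_le_add (add_le_add (hbd L ⟨hL.le, le_rfl⟩) (hbd 0 ⟨le_rfl, hL.le⟩)) hPint
    _ = _ := by ring

/-- The pairing of an integral frequency with a point of the plane. -/
def freqDot (v : ℤ × ℤ) (z : ℝ × ℝ) : ℝ := (v.1 : ℝ) * z.1 + (v.2 : ℝ) * z.2

/-- The plane wave of frequency `v` restricted to the curve `γ`. -/
def curveWave (γ : ℝ → ℝ × ℝ) (v : ℤ × ℤ) (t : ℝ) : ℂ :=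
  Complex.exp (2 * π * Complex.I * freqDot v (γ t))

theorem norm_curveWave (γ : ℝ → ℝ × ℝ) (v : ℤ × ℤ) (t : ℝ) : ‖curveWave γ v t‖ = 1 := by
  rw [curveWave, show (2 * π * Complex.I * freqDot v (γ t) : ℂ) =
    ((2 * π * freqDot v (γ t) : ℝ) : ℂ) * Complex.I by push_cast; ring, Complex.norm_exp_ofReal_mul_I]

theorem curveWave_add (γ : ℝ → ℝ × ℝ) (v w : ℤ × ℤ) (t : ℝ) :
    curveWave γ (v + w) t = curveWave γ v t * curveWave γ w t := by
  simp only [curveWave, ← Complex.exp_add, freqDot, Prod.fst_add, Prod.snd_add]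
  congr 1
  push_cast
  ring

theorem hasDerivAt_fst_snd {z : ℝ → ℝ × ℝ} {z' : ℝ × ℝ} {t : ℝ} (h : HasDerivAt z z' t) :
    HasDerivAt (fun s => (z s).1) z'.1 t ∧ HasDerivAt (fun s => (z s).2) z'.2 t :=
  ⟨h.hasFDerivAt.fst.hasDerivAt.congr_deriv (by simp),
    h.hasFDerivAt.snd.hasDerivAt.congr_deriv (by simp)⟩

theorem HasDerivAt.freqDot {z : ℝ → ℝ × ℝ} {z' : ℝ × ℝ} {t : ℝ} (h : HasDerivAt z z' t)
    (v : ℤ × ℤ) : HasDerivAt (fun s => freqDot v (z s)) (freqDot v z') t :=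
  ((hasDerivAt_fst_snd h).1.const_mul (v.1 : ℝ)).add ((hasDerivAt_fst_snd h).2.const_mul (v.2 : ℝ))

theorem Continuous.freqDot {z : ℝ → ℝ × ℝ} (h : Continuous z) (v : ℤ × ℤ) :
    Continuous fun s => freqDot v (z s) :=
  (continuous_const.mul h.fst).add (continuous_const.mul h.snd)

theorem hasDerivAt_curveWave {γ : ℝ → ℝ × ℝ} {z : ℝ × ℝ} {t : ℝ} (h : HasDerivAt γ z t)
    (v : ℤ × ℤ) :
    HasDerivAt (curveWave γ v) (2 * π * Complex.I * freqDot v z * curveWave γ v t) t := by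
  have h1 := (((h.freqDot v).ofReal_comp).const_mul (2 * π * Complex.I : ℂ)).cexp
  refine h1.congr_deriv ?_
  rw [curveWave]
  ring

/-- The structure equations of a curve parametrised by arc length. -/
theorem frenet {L : ℝ} (hL : 0 < L) {γ : ℝ → ℝ × ℝ} (hγ : ContDiff ℝ (⊤ : ℕ∞) γ)
    (hunit : ∀ t ∈ Set.Icc (0 : ℝ) L, (deriv γ t).1 ^ 2 + (deriv γ t).2 ^ 2 = 1) {t : ℝ}
    (ht : t ∈ Set.Icc (0 : ℝ) L) :
    (deriv (deriv γ) t).1 = -(((deriv γ t).1 * (deriv (deriv γ) t).2 -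
      (deriv γ t).2 * (deriv (deriv γ) t).1) * (deriv γ t).2) ∧
    (deriv (deriv γ) t).2 = ((deriv γ t).1 * (deriv (deriv γ) t).2 -
      (deriv γ t).2 * (deriv (deriv γ) t).1) * (deriv γ t).1 := by
  have h1 := (contDiff_infty_iff_deriv.1 hγ).2
  have h2 := ((contDiff_infty_iff_deriv.1 h1).1 t).hasDerivAt
  obtain ⟨hx, hy⟩ := hasDerivAt_fst_snd h2
  have h3 := ((hx.pow 2).add (hy.pow 2)).hasDerivWithinAt (s := Set.Icc 0 L)
  have h4 : HasDerivWithinAt (fun _ : ℝ => (1 : ℝ)) 0 (Set.Icc 0 L) t := hasDerivWithinAt_const _ _ _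
  have h5 := h4.congr (f₁ := (fun t => (deriv γ t).1) ^ 2 + (fun t => (deriv γ t).2) ^ 2)
    (fun s hs => hunit s hs) (hunit t ht)
  have h6 := (uniqueDiffOn_Icc hL t ht).eq_deriv _ h3 h5
  have h7 := hunit t ht
  simp only [Nat.cast_ofNat, Nat.add_one_sub_one, pow_one] at h6
  generalize (deriv γ t).1 = x at *
  generalize (deriv γ t).2 = y at *
  generalize (deriv (deriv γ) t).1 = x' at *
  generalize (deriv (deriv γ) t).2 = y' at *
  constructor
  · linear_combination (-x') * h7 + x / 2 * h6
  · linear_combination (-y') * h7 + y / 2 * h6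

/-- Decay of Fourier-type integrals along a curve with nonvanishing curvature. -/
theorem exists_norm_integral_curveWave_le {L : ℝ} (hL : 0 < L) {γ : ℝ → ℝ × ℝ}
    (hγ : ContDiff ℝ (⊤ : ℕ∞) γ)
    (hunit : ∀ t ∈ Set.Icc (0 : ℝ) L, (deriv γ t).1 ^ 2 + (deriv γ t).2 ^ 2 = 1)
    (hcurv : ∀ t ∈ Set.Icc (0 : ℝ) L, deriv (deriv γ) t ≠ 0) :
    ∃ C : ℝ, 0 < C ∧ ∀ (v : ℤ × ℤ) (A A' : ℝ → ℂ) (K : ℝ), (∀ t, HasDerivAt A (A' t) t) →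
      Continuous A' → (∀ t ∈ Set.Icc 0 L, ‖A t‖ ≤ K) → (∀ t ∈ Set.Icc 0 L, ‖A' t‖ ≤ K) →
      ‖∫ t in (0 : ℝ)..L, A t * curveWave γ v t‖ ≤ C * K * √(freqWeight v) := by
  obtain ⟨d0, c1⟩ := contDiff_infty_iff_deriv.1 hγ
  obtain ⟨d1, c2⟩ := contDiff_infty_iff_deriv.1 c1
  obtain ⟨d2, c3⟩ := contDiff_infty_iff_deriv.1 c2
  set κ : ℝ → ℝ := fun t => (deriv γ t).1 * (deriv (deriv γ) t).2 -
      (deriv γ t).2 * (deriv (deriv γ) t).1 with hκdef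
  have hκs : ContDiff ℝ (⊤ : ℕ∞) κ := (c1.fst.mul c2.snd).sub (c1.snd.mul c2.fst)
  obtain ⟨dκ, cκ⟩ := contDiff_infty_iff_deriv.1 hκs
  have hfr := fun t ht => frenet (t := t) hL hγ hunit ht
  have hκ0 : ∀ t ∈ Set.Icc 0 L, κ t ≠ 0 := by
    intro t ht h
    obtain ⟨h1, h2⟩ := hfr t ht
    apply hcurv t ht
    change _ = -(κ t * _) at h1
    change _ = κ t * _ at h2
    rw [h, zero_mul] at h1 h2
    rw [neg_zero] at h1
    exact Prod.ext h1 h2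
  obtain ⟨t₀, ht₀, hmin⟩ := isCompact_Icc.exists_isMinOn (Set.nonempty_Icc.2 hL.le)
    hκs.continuous.abs.continuousOn
  obtain ⟨B₁, hB₁⟩ := isCompact_Icc.exists_bound_of_continuousOn
    (hκs.continuous.continuousOn (s := Set.Icc 0 L))
  obtain ⟨B₂, hB₂⟩ := isCompact_Icc.exists_bound_of_continuousOn
    (cκ.continuous.continuousOn (s := Set.Icc 0 L))
  obtain ⟨C, hC, hmain⟩ := exists_norm_integral_le hL (B := max B₁ B₂) (fun t => (dκ t).hasDerivAt)
    cκ.continuous (abs_pos.2 (hκ0 t₀ ht₀)) (fun t ht => hmin ht)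
    (fun t ht => (hB₁ t ht).trans (le_max_left _ _))
    (fun t ht => (hB₂ t ht).trans (le_max_right _ _))
  refine ⟨2 * C + L, by positivity, ?_⟩
  intro v A A' K hA hA' hAK hAK'
  have hK : 0 ≤ K := (norm_nonneg _).trans (hAK 0 ⟨le_rfl, hL.le⟩)
  by_cases hv : v = 0
  · have h1 : freqWeight v = 1 := by simp [freqWeight, hv]
    rw [h1, Real.sqrt_one, mul_one]
    have h2 := intervalIntegral.norm_integral_le_of_norm_le_const
      (f := fun t => A t * curveWave γ v t) (a := 0) (b := L) (C := K) fun t ht => by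
        rw [Set.uIoc_of_le hL.le] at ht
        rw [norm_mul, norm_curveWave, mul_one]
        exact hAK t ⟨ht.1.le, ht.2⟩
    rw [sub_zero, abs_of_pos hL] at h2
    refine h2.trans ?_
    nlinarith [mul_nonneg hC.le hK]
  have hV : 1 ≤ (v.1 : ℝ) ^ 2 + (v.2 : ℝ) ^ 2 := by
    have := sq_dist_pos hv
    simp only [Prod.fst_zero, Prod.snd_zero, sub_zero] at this
    exact_mod_cast this
  set V : ℝ := (v.1 : ℝ) ^ 2 + (v.2 : ℝ) ^ 2 with hVdef
  set R : ℝ := √(√V) with hRdef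
  have hR : 1 ≤ R := Real.one_le_sqrt.2 (Real.one_le_sqrt.2 hV)
  have hR0 : 0 < R := by linarith
  have hR4 : R ^ 4 = V := by
    rw [show R ^ 4 = (R ^ 2) ^ 2 by ring, hRdef, Real.sq_sqrt (Real.sqrt_nonneg _),
      Real.sq_sqrt (by linarith)]
  have hRw : 1 / R ≤ 2 * √(freqWeight v) := by
    have h1 : freqWeight v = (√(1 + V))⁻¹ := by rw [freqWeight, hVdef, add_assoc]
    have h2 : √(√(1 + V)) ≤ 2 * R := by
      rw [Real.sqrt_le_iff]
      refine ⟨by positivity, ?_⟩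
      rw [Real.sqrt_le_iff]
      refine ⟨by positivity, ?_⟩
      have : ((2 * R) ^ 2) ^ 2 = 16 * V := by rw [← hR4]; ring
      rw [this]
      linarith
    have h3 : 0 < √(√(1 + V)) := Real.sqrt_pos.2 (Real.sqrt_pos.2 (by linarith))
    rw [h1, Real.sqrt_inv, ← div_eq_mul_inv, div_le_div_iff₀ hR0 h3]
    linarith
  have hmain' := hmain R (fun t => freqDot v (deriv γ t))
    (fun t => freqDot (-v.2, v.1) (deriv γ t)) hR (c1.continuous.freqDot v)
    (c1.continuous.freqDot _)
    (fun t ht => by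
      refine ((d1 t).hasDerivAt.freqDot v).congr_deriv ?_
      obtain ⟨h1, h2⟩ := hfr t ht
      simp only [freqDot, hκdef]
      push_cast
      linear_combination (v.1 : ℝ) * h1 + (v.2 : ℝ) * h2)
    (fun t ht => by
      refine ((d1 t).hasDerivAt.freqDot _).congr_deriv ?_
      obtain ⟨h1, h2⟩ := hfr t ht
      simp only [freqDot, hκdef]
      push_cast
      linear_combination -(v.2 : ℝ) * h1 + (v.1 : ℝ) * h2)
    (fun t ht => by
      simp only [freqDot]
      push_cast
      rw [hR4, hVdef]
      linear_combination ((v.1 : ℝ) ^ 2 + (v.2 : ℝ) ^ 2) * hunit t ht)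
    (curveWave γ v) A A' K (fun t => hasDerivAt_curveWave (d0 t).hasDerivAt v)
    (norm_curveWave γ v) hA hA' hAK hAK'
  calc _ ≤ C * K * (1 / R) := hmain'.trans_eq (by ring)
    _ ≤ C * K * (2 * √(freqWeight v)) := by gcongr
    _ = 2 * C * K * √(freqWeight v) := by ring
    _ ≤ (2 * C + L) * K * √(freqWeight v) := by
      gcongr
      linarith

/-- A continuously differentiable amplitude, bounded by `K` with derivative bounded by `D` on
`[0, L]`. -/
def IsAmplitude (L : ℝ) (A : ℝ → ℂ) (K D : ℝ) : Prop :=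
  ∃ A' : ℝ → ℂ, (∀ t, HasDerivAt A (A' t) t) ∧ Continuous A' ∧
    (∀ t ∈ Set.Icc 0 L, ‖A t‖ ≤ K) ∧ ∀ t ∈ Set.Icc 0 L, ‖A' t‖ ≤ D

theorem IsAmplitude.continuous {L K D : ℝ} {A : ℝ → ℂ} (h : IsAmplitude L A K D) :
    Continuous A := by
  obtain ⟨A', hA, -⟩ := h
  exact continuous_iff_continuousAt.2 fun t => (hA t).continuousAt

theorem IsAmplitude.mul {L K D K' D' : ℝ} {A B : ℝ → ℂ} (hA : IsAmplitude L A K D)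
    (hB : IsAmplitude L B K' D') :
    IsAmplitude L (fun t => A t * B t) (K * K') (D * K' + K * D') := by
  have hAc := hA.continuous
  have hBc := hB.continuous
  obtain ⟨A', a1, a2, a3, a4⟩ := hA
  obtain ⟨B', b1, b2, b3, b4⟩ := hB
  refine ⟨fun t => A' t * B t + A t * B' t, fun t => (a1 t).mul (b1 t),
    (a2.mul hBc).add (hAc.mul b2), fun t ht => ?_, fun t ht => ?_⟩
  · rw [norm_mul]
    exact mul_le_mul (a3 t ht) (b3 t ht) (norm_nonneg _) ((norm_nonneg _).trans (a3 t ht))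
  · refine (norm_add_le _ _).trans ?_
    rw [norm_mul, norm_mul]
    exact add_le_add
      (mul_le_mul (a4 t ht) (b3 t ht) (norm_nonneg _) ((norm_nonneg _).trans (a4 t ht)))
      (mul_le_mul (a3 t ht) (b4 t ht) (norm_nonneg _) ((norm_nonneg _).trans (a3 t ht)))

/-- The product of a family over the entries of a quadruple. -/
def quadProd (c : ℤ × ℤ → ℂ) (x : ((ℤ × ℤ) × (ℤ × ℤ)) × ((ℤ × ℤ) × (ℤ × ℤ))) : ℂ :=
  c x.1.1 * c x.1.2 * (c x.2.1 * c x.2.2)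

theorem mem_latticeQuads {m : ℕ} {x : ((ℤ × ℤ) × (ℤ × ℤ)) × ((ℤ × ℤ) × (ℤ × ℤ))} :
    x ∈ latticeQuads m ↔ (x.1.1 ∈ latticeSet m ∧ x.1.2 ∈ latticeSet m) ∧
      x.2.1 ∈ latticeSet m ∧ x.2.2 ∈ latticeSet m := by
  simp only [latticeQuads, latticePairs, Finset.mem_product]

theorem sum_pow_four (m : ℕ) (c : ℤ × ℤ → ℂ) :
    (∑ μ ∈ latticeSet m, c μ) ^ 4 = ∑ x ∈ latticeQuads m, quadProd c x := by
  have h : (∑ μ ∈ latticeSet m, c μ) * (∑ μ ∈ latticeSet m, c μ) =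
      ∑ p ∈ latticePairs m, c p.1 * c p.2 := by
    rw [latticePairs, Finset.sum_product, Finset.sum_mul_sum]
  calc (∑ μ ∈ latticeSet m, c μ) ^ 4 = ((∑ μ ∈ latticeSet m, c μ) * (∑ μ ∈ latticeSet m, c μ)) *
        ((∑ μ ∈ latticeSet m, c μ) * (∑ μ ∈ latticeSet m, c μ)) := by ring
    _ = _ := by
      rw [h, latticeQuads, Finset.sum_product, Finset.sum_mul_sum]
      rfl

theorem quadProd_mul (c d : ℤ × ℤ → ℂ) (x : ((ℤ × ℤ) × (ℤ × ℤ)) × ((ℤ × ℤ) × (ℤ × ℤ))) :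
    quadProd (fun μ => c μ * d μ) x = quadProd c x * quadProd d x := by
  simp only [quadProd]
  ring

theorem quadProd_curveWave (γ : ℝ → ℝ × ℝ) (t : ℝ)
    (x : ((ℤ × ℤ) × (ℤ × ℤ)) × ((ℤ × ℤ) × (ℤ × ℤ))) :
    quadProd (fun μ => curveWave γ μ t) x = curveWave γ (quadSum x) t := by
  simp only [quadProd, quadSum, curveWave_add]

theorem quadProd_curveWave_neg (γ : ℝ → ℝ × ℝ) (t : ℝ)
    (x : ((ℤ × ℤ) × (ℤ × ℤ)) × ((ℤ × ℤ) × (ℤ × ℤ))) :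
    quadProd (fun μ => curveWave γ (-μ) t) x = curveWave γ (-quadSum x) t := by
  simp only [quadProd, quadSum, neg_add, curveWave_add]

theorem isAmplitude_quadProd {L K : ℝ} {m : ℕ} {a : ℤ × ℤ → ℝ → ℂ}
    (ha : ∀ μ ∈ latticeSet m, IsAmplitude L (a μ) K K)
    {x : ((ℤ × ℤ) × (ℤ × ℤ)) × ((ℤ × ℤ) × (ℤ × ℤ))} (hx : x ∈ latticeQuads m) :
    IsAmplitude L (fun t => quadProd (fun μ => a μ t) x) (K ^ 4) (4 * K ^ 4) := by
  rw [mem_latticeQuads] at hx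
  obtain ⟨⟨h1, h2⟩, h3, h4⟩ := hx
  convert ((ha _ h1).mul (ha _ h2)).mul ((ha _ h3).mul (ha _ h4)) using 1
  · rfl
  · ring
  · ring

theorem continuous_curveWave {γ : ℝ → ℝ × ℝ} (hγ : Continuous γ) (v : ℤ × ℤ) :
    Continuous (curveWave γ v) :=
  Complex.continuous_exp.comp
    (continuous_const.mul (Complex.continuous_ofReal.comp (hγ.freqDot v)))

theorem freqWeight_neg (v : ℤ × ℤ) : freqWeight (-v) = freqWeight v := by
  simp [freqWeight]

/-- Fourth moments of bilinear exponential sums along the curve. -/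
theorem exists_integral_pow_four_le {L : ℝ} (hL : 0 < L) {γ : ℝ → ℝ × ℝ}
    (hγ : ContDiff ℝ (⊤ : ℕ∞) γ)
    (hunit : ∀ t ∈ Set.Icc (0 : ℝ) L, (deriv γ t).1 ^ 2 + (deriv γ t).2 ^ 2 = 1)
    (hcurv : ∀ t ∈ Set.Icc (0 : ℝ) L, deriv (deriv γ) t ≠ 0) :
    ∃ C : ℝ, 0 < C ∧ ∀ m : ℕ, 0 < m → 0 < latN m → ∀ (F : ℝ → ℝ → ℝ) (a b : ℤ × ℤ → ℝ → ℂ)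
      (K₁ K₂ : ℝ), (∀ μ ∈ latticeSet m, IsAmplitude L (a μ) K₁ K₁) →
      (∀ μ ∈ latticeSet m, IsAmplitude L (b μ) K₂ K₂) →
      (∀ t₁ t₂, (F t₁ t₂ : ℂ) = (latN m : ℂ)⁻¹ * ∑ μ ∈ latticeSet m,
        a μ t₁ * curveWave γ μ t₁ * (b μ t₂ * curveWave γ (-μ) t₂)) →
      ∫ t₁ in (0 : ℝ)..L, ∫ t₂ in (0 : ℝ)..L, F t₁ t₂ ^ 4 ≤
        C * (K₁ ^ 4 * K₂ ^ 4) / (latN m : ℝ) ^ ((3 : ℝ) / 2) := by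
  obtain ⟨C₁, hC₁, hI⟩ := exists_norm_integral_curveWave_le hL hγ hunit hcurv
  obtain ⟨C₂, hC₂, hS⟩ := exists_sum_freqWeight_le
  refine ⟨16 * C₁ ^ 2 * C₂, by positivity, ?_⟩
  intro m hm hN F a b K₁ K₂ ha hb hF
  have hN' : (0 : ℝ) < latN m := by exact_mod_cast hN
  have hγc := hγ.continuous
  set P : _ → ℝ → ℂ := fun x t => quadProd (fun μ => a μ t) x * curveWave γ (quadSum x) t with hP
  set Q : _ → ℝ → ℂ := fun x t => quadProd (fun μ => b μ t) x * curveWave γ (-quadSum x) t with hQ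
  have hPc : ∀ x ∈ latticeQuads m, Continuous (P x) := fun x hx =>
    (isAmplitude_quadProd ha hx).continuous.mul (continuous_curveWave hγc _)
  have hQc : ∀ x ∈ latticeQuads m, Continuous (Q x) := fun x hx =>
    (isAmplitude_quadProd hb hx).continuous.mul (continuous_curveWave hγc _)
  have hF4 : ∀ t₁ t₂, ((F t₁ t₂ ^ 4 : ℝ) : ℂ) =
      ((latN m : ℂ)⁻¹) ^ 4 * ∑ x ∈ latticeQuads m, P x t₁ * Q x t₂ := by
    intro t₁ t₂
    rw [Complex.ofReal_pow, hF, mul_pow, sum_pow_four]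
    congr 1
    refine Finset.sum_congr rfl fun x _ => ?_
    simp only [quadProd_mul, quadProd_curveWave, quadProd_curveWave_neg, hP, hQ]
  have hint : ((∫ t₁ in (0 : ℝ)..L, ∫ t₂ in (0 : ℝ)..L, F t₁ t₂ ^ 4 : ℝ) : ℂ) =
      ((latN m : ℂ)⁻¹) ^ 4 * ∑ x ∈ latticeQuads m,
        (∫ t in (0 : ℝ)..L, P x t) * ∫ t in (0 : ℝ)..L, Q x t := by
    rw [← intervalIntegral.integral_ofReal]
    have h1 : ∀ t₁ : ℝ, ((∫ t₂ in (0 : ℝ)..L, F t₁ t₂ ^ 4 : ℝ) : ℂ) =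
        ((latN m : ℂ)⁻¹) ^ 4 * ∑ x ∈ latticeQuads m, P x t₁ * ∫ t in (0 : ℝ)..L, Q x t := by
      intro t₁
      rw [← intervalIntegral.integral_ofReal]
      simp_rw [hF4]
      rw [intervalIntegral.integral_const_mul, intervalIntegral.integral_finsetSum
        fun x hx => ((hQc x hx).intervalIntegrable 0 L).const_mul (P x t₁)]
      simp_rw [intervalIntegral.integral_const_mul]
    simp_rw [h1]
    rw [intervalIntegral.integral_const_mul, intervalIntegral.integral_finsetSum
      fun x hx => ((hPc x hx).intervalIntegrable 0 L).mul_const _]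
    simp_rw [intervalIntegral.integral_mul_const]
  have hle : ∀ {c : ℤ × ℤ → ℝ → ℂ} {K : ℝ}, (∀ μ ∈ latticeSet m, IsAmplitude L (c μ) K K) →
      ∀ x ∈ latticeQuads m, ∀ v, ‖∫ t in (0 : ℝ)..L, quadProd (fun μ => c μ t) x *
        curveWave γ v t‖ ≤ C₁ * (4 * K ^ 4) * √(freqWeight v) := by
    intro c K hc x hx v
    obtain ⟨A', h1, h2, h3, h4⟩ := isAmplitude_quadProd hc hx
    refine hI v _ A' _ h1 h2 (fun t ht => (h3 t ht).trans ?_) h4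
    nlinarith [Even.pow_nonneg (by decide : Even 4) K]
  have hterm : ∀ x ∈ latticeQuads m,
      ‖(∫ t in (0 : ℝ)..L, P x t) * ∫ t in (0 : ℝ)..L, Q x t‖ ≤
        16 * C₁ ^ 2 * (K₁ ^ 4 * K₂ ^ 4) * freqWeight (quadSum x) := by
    intro x hx
    have h1 := hle ha x hx (quadSum x)
    have h2 := hle hb x hx (-quadSum x)
    rw [freqWeight_neg] at h2
    rw [norm_mul]
    calc _ ≤ C₁ * (4 * K₁ ^ 4) * √(freqWeight (quadSum x)) *
          (C₁ * (4 * K₂ ^ 4) * √(freqWeight (quadSum x))) :=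
          mul_le_mul h1 h2 (norm_nonneg _) ((norm_nonneg _).trans h1)
      _ = 16 * C₁ ^ 2 * (K₁ ^ 4 * K₂ ^ 4) *
          (√(freqWeight (quadSum x)) * √(freqWeight (quadSum x))) := by ring
      _ = _ := by rw [Real.mul_self_sqrt (freqWeight_nonneg _)]
  have hK4 : 0 ≤ K₁ ^ 4 * K₂ ^ 4 := by positivity
  have hpow : (latN m : ℝ) ^ ((3 : ℝ) / 2) = latN m * √(latN m) := by
    rw [show (3 : ℝ) / 2 = 1 + 1 / 2 by norm_num, Real.rpow_add hN', Real.rpow_one,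
      ← Real.sqrt_eq_rpow]
  have hs0 : 0 < √(latN m : ℝ) := Real.sqrt_pos.2 hN'
  calc ∫ t₁ in (0 : ℝ)..L, ∫ t₂ in (0 : ℝ)..L, F t₁ t₂ ^ 4
      ≤ ‖((∫ t₁ in (0 : ℝ)..L, ∫ t₂ in (0 : ℝ)..L, F t₁ t₂ ^ 4 : ℝ) : ℂ)‖ := by
        rw [Complex.norm_real]
        exact Real.le_norm_self _
    _ ≤ ((latN m : ℝ)⁻¹) ^ 4 * ∑ x ∈ latticeQuads m,
          16 * C₁ ^ 2 * (K₁ ^ 4 * K₂ ^ 4) * freqWeight (quadSum x) := by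
        rw [hint, norm_mul, norm_pow, norm_inv, Complex.norm_natCast]
        gcongr
        exact (norm_sum_le _ _).trans (Finset.sum_le_sum hterm)
    _ ≤ ((latN m : ℝ)⁻¹) ^ 4 * (16 * C₁ ^ 2 * (K₁ ^ 4 * K₂ ^ 4) *
          (C₂ * ((latN m : ℝ) ^ 2 * √(latN m)))) := by
        rw [← Finset.mul_sum]
        gcongr
        exact hS m hm hN
    _ = 16 * C₁ ^ 2 * C₂ * (K₁ ^ 4 * K₂ ^ 4) / (latN m : ℝ) ^ ((3 : ℝ) / 2) := by
        rw [hpow]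
        field_simp
        rw [Real.sq_sqrt hN'.le]
        ring

theorem neg_mem_latticeSet {m : ℕ} {μ : ℤ × ℤ} : -μ ∈ latticeSet m ↔ μ ∈ latticeSet m := by
  simp [mem_latticeSet_s16]

theorem curveWave_mul_neg (γ : ℝ → ℝ × ℝ) (μ : ℤ × ℤ) (t₁ t₂ : ℝ) :
    curveWave γ μ t₁ * curveWave γ (-μ) t₂ =
      Complex.exp ((2 * π * freqDot μ (γ t₁ - γ t₂) : ℝ) * Complex.I) := by
  simp only [curveWave, ← Complex.exp_add, freqDot, Prod.fst_sub, Prod.snd_sub, Prod.fst_neg,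
    Prod.snd_neg]
  congr 1
  push_cast
  ring

/-- The covariance function as a bilinear exponential sum. -/
theorem ofReal_covFn (m : ℕ) (γ : ℝ → ℝ × ℝ) (t₁ t₂ : ℝ) :
    (covFn m γ t₁ t₂ : ℂ) = (latN m : ℂ)⁻¹ *
      ∑ μ ∈ latticeSet m, curveWave γ μ t₁ * curveWave γ (-μ) t₂ := by
  set θ : ℤ × ℤ → ℝ := fun μ => 2 * π * freqDot μ (γ t₁ - γ t₂) with hθ
  have hsin : ∑ μ ∈ latticeSet m, Real.sin (θ μ) = 0 := by
    have h : ∑ μ ∈ latticeSet m, Real.sin (θ μ) = ∑ μ ∈ latticeSet m, -Real.sin (θ μ) := by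
      refine Finset.sum_equiv (Equiv.neg _) (fun μ => neg_mem_latticeSet.symm) fun μ _ => ?_
      rw [← Real.sin_neg]
      congr 1
      simp only [hθ, freqDot, Equiv.neg_apply, Prod.fst_neg, Prod.snd_neg]
      push_cast
      ring
    rw [Finset.sum_neg_distrib] at h
    linarith
  simp_rw [curveWave_mul_neg, Complex.exp_mul_I]
  rw [Finset.sum_add_distrib, ← Finset.sum_mul]
  simp_rw [← Complex.ofReal_sin, ← Complex.ofReal_cos]
  rw [← Complex.ofReal_sum, ← Complex.ofReal_sum, hsin, covFn]
  simp [freqDot]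

/-- Differentiating a real function through a complex formula for it. -/
theorem ofReal_deriv_eq {F : ℝ → ℝ} {G : ℝ → ℂ} (hFG : ∀ s, (F s : ℂ) = G s) {D : ℂ} {t : ℝ}
    (hG : HasDerivAt G D t) : ((deriv F t : ℝ) : ℂ) = D := by
  have hF : HasDerivAt F D.re t := by
    have h := Complex.reCLM.hasFDerivAt.comp_hasDerivAt t hG
    refine h.congr_of_eventuallyEq (Filter.Eventually.of_forall fun s => ?_)
    simp [← hFG]
  have h2 := hF.ofReal_comp
  rw [funext hFG] at h2
  rw [hF.deriv, h2.unique hG]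

/-- The factor produced by differentiating `curveWave γ v`. -/
def waveFactor (γ : ℝ → ℝ × ℝ) (v : ℤ × ℤ) (t : ℝ) : ℂ :=
  2 * π * Complex.I * freqDot v (deriv γ t)

theorem hasDerivAt_curveWave_waveFactor {γ : ℝ → ℝ × ℝ} (hγ : Differentiable ℝ γ) (v : ℤ × ℤ)
    (t : ℝ) : HasDerivAt (curveWave γ v) (waveFactor γ v t * curveWave γ v t) t :=
  hasDerivAt_curveWave (hγ t).hasDerivAt v

theorem ofReal_covFn1 (m : ℕ) {γ : ℝ → ℝ × ℝ} (hγ : Differentiable ℝ γ) (t₁ t₂ : ℝ) :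
    (covFn1 m γ t₁ t₂ : ℂ) = (latN m : ℂ)⁻¹ *
      ∑ μ ∈ latticeSet m, waveFactor γ μ t₁ * curveWave γ μ t₁ * curveWave γ (-μ) t₂ :=
  ofReal_deriv_eq (fun s => ofReal_covFn m γ s t₂) ((HasDerivAt.fun_sum fun μ _ =>
    (hasDerivAt_curveWave_waveFactor hγ μ t₁).mul_const _).const_mul _)

theorem ofReal_covFn2 (m : ℕ) {γ : ℝ → ℝ × ℝ} (hγ : Differentiable ℝ γ) (t₁ t₂ : ℝ) :
    (covFn2 m γ t₁ t₂ : ℂ) = (latN m : ℂ)⁻¹ *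
      ∑ μ ∈ latticeSet m, curveWave γ μ t₁ * (waveFactor γ (-μ) t₂ * curveWave γ (-μ) t₂) :=
  ofReal_deriv_eq (fun s => ofReal_covFn m γ t₁ s) ((HasDerivAt.fun_sum fun μ _ =>
    (hasDerivAt_curveWave_waveFactor hγ (-μ) t₂).const_mul _).const_mul _)

theorem ofReal_covFn12 (m : ℕ) {γ : ℝ → ℝ × ℝ} (hγ : Differentiable ℝ γ) (t₁ t₂ : ℝ) :
    (covFn12 m γ t₁ t₂ : ℂ) = (latN m : ℂ)⁻¹ * ∑ μ ∈ latticeSet m,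
      waveFactor γ μ t₁ * curveWave γ μ t₁ * (waveFactor γ (-μ) t₂ * curveWave γ (-μ) t₂) :=
  ofReal_deriv_eq (fun s => ofReal_covFn2 m hγ s t₂) ((HasDerivAt.fun_sum fun μ _ =>
    (hasDerivAt_curveWave_waveFactor hγ μ t₁).mul_const _).const_mul _)

theorem isAmplitude_one (L : ℝ) : IsAmplitude L (fun _ => 1) 1 1 :=
  ⟨fun _ => 0, fun t => hasDerivAt_const t 1, continuous_const, fun _ _ => by simp,
    fun _ _ => by simp⟩

theorem norm_two_pi_mul_freqDot_le {m : ℕ} {μ : ℤ × ℤ} (hμ : μ ∈ latticeSet m) {z : ℝ × ℝ} {M : ℝ}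
    (hz : ‖z‖ ≤ M) : ‖(2 * π * Complex.I * freqDot μ z : ℂ)‖ ≤ 16 * M * √m := by
  rw [mem_latticeSet_s16] at hμ
  have hm : (μ.1 : ℝ) ^ 2 + (μ.2 : ℝ) ^ 2 = m := by exact_mod_cast hμ
  have h1 : |(μ.1 : ℝ)| ≤ √m := Real.abs_le_sqrt (by nlinarith [sq_nonneg (μ.2 : ℝ)])
  have h2 : |(μ.2 : ℝ)| ≤ √m := Real.abs_le_sqrt (by nlinarith [sq_nonneg (μ.1 : ℝ)])
  have hM : 0 ≤ M := (norm_nonneg _).trans hz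
  have h3 : |freqDot μ z| ≤ √m * M + √m * M := by
    refine (abs_add_le _ _).trans ?_
    rw [abs_mul, abs_mul]
    gcongr
    · exact (norm_fst_le z).trans hz
    · exact (norm_snd_le z).trans hz
  simp only [norm_mul, Complex.norm_I, Complex.norm_real, Real.norm_eq_abs, mul_one,
    abs_of_pos Real.pi_pos, Complex.norm_ofNat]
  calc 2 * π * |freqDot μ z| ≤ 2 * 4 * (√m * M + √m * M) := by
        gcongr
        exact Real.pi_le_four
    _ = _ := by ring

theorem isAmplitude_waveFactor {L M : ℝ} {m : ℕ} {γ : ℝ → ℝ × ℝ} (hγ : ContDiff ℝ (⊤ : ℕ∞) γ)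
    (h₁ : ∀ t ∈ Set.Icc 0 L, ‖deriv γ t‖ ≤ M) (h₂ : ∀ t ∈ Set.Icc 0 L, ‖deriv (deriv γ) t‖ ≤ M)
    {μ : ℤ × ℤ} (hμ : μ ∈ latticeSet m) :
    IsAmplitude L (waveFactor γ μ) (16 * M * √m) (16 * M * √m) := by
  obtain ⟨-, c1⟩ := contDiff_infty_iff_deriv.1 hγ
  obtain ⟨d1, c2⟩ := contDiff_infty_iff_deriv.1 c1
  refine ⟨fun t => 2 * π * Complex.I * freqDot μ (deriv (deriv γ) t), fun t => ?_, ?_,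
    fun t ht => norm_two_pi_mul_freqDot_le hμ (h₁ t ht),
    fun t ht => norm_two_pi_mul_freqDot_le hμ (h₂ t ht)⟩
  · exact (((d1 t).hasDerivAt.freqDot μ).ofReal_comp).const_mul _
  · exact continuous_const.mul (Complex.continuous_ofReal.comp (c2.continuous.freqDot μ))

/-- Fourth-moment bounds for the covariance function and its derivatives along the curve. -/
theorem fourth_moment_bounds
    (L : ℝ) (hL : 0 < L) (γ : ℝ → ℝ × ℝ) (hγ : ContDiff ℝ (⊤ : ℕ∞) γ)
    (hunit : ∀ t ∈ Set.Icc (0:ℝ) L, (deriv γ t).1 ^ 2 + (deriv γ t).2 ^ 2 = 1)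
    (hcurv : ∀ t ∈ Set.Icc (0:ℝ) L, deriv (deriv γ) t ≠ 0) :
    ∃ C > 0, ∀ m : ℕ, 0 < m →
      (∃ a b : ℤ, a ^ 2 + b ^ 2 = (m : ℤ)) →
      (∫ t₁ in (0:ℝ)..L, ∫ t₂ in (0:ℝ)..L, covFn m γ t₁ t₂ ^ 4)
          ≤ C / (latN m : ℝ) ^ ((3:ℝ)/2) ∧
      ((m : ℝ) ^ 2)⁻¹ * (∫ t₁ in (0:ℝ)..L, ∫ t₂ in (0:ℝ)..L, covFn1 m γ t₁ t₂ ^ 4)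
          ≤ C / (latN m : ℝ) ^ ((3:ℝ)/2) ∧
      ((m : ℝ) ^ 2)⁻¹ * (∫ t₁ in (0:ℝ)..L, ∫ t₂ in (0:ℝ)..L, covFn2 m γ t₁ t₂ ^ 4)
          ≤ C / (latN m : ℝ) ^ ((3:ℝ)/2) ∧
      ((m : ℝ) ^ 4)⁻¹ * (∫ t₁ in (0:ℝ)..L, ∫ t₂ in (0:ℝ)..L, covFn12 m γ t₁ t₂ ^ 4)
          ≤ C / (latN m : ℝ) ^ ((3:ℝ)/2) := by
  obtain ⟨d0, c1⟩ := contDiff_infty_iff_deriv.1 hγ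
  obtain ⟨-, c2⟩ := contDiff_infty_iff_deriv.1 c1
  obtain ⟨M₁, hM₁⟩ := isCompact_Icc.exists_bound_of_continuousOn
    (c1.continuous.continuousOn (s := Set.Icc 0 L))
  obtain ⟨M₂, hM₂⟩ := isCompact_Icc.exists_bound_of_continuousOn
    (c2.continuous.continuousOn (s := Set.Icc 0 L))
  obtain ⟨C, hC, hmain⟩ := exists_integral_pow_four_le hL hγ hunit hcurv
  set M : ℝ := max 1 (max M₁ M₂) with hM
  have hM1 : 1 ≤ M := le_max_left _ _
  set c : ℝ := (16 * M) ^ 4 with hc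
  have hc1 : 1 ≤ c := one_le_pow₀ (by linarith)
  refine ⟨C * c ^ 2, by positivity, fun m hm ⟨x, y, hxy⟩ => ?_⟩
  have hN : 0 < latN m := Finset.card_pos.2 ⟨(x, y), mem_latticeSet_s16.2 hxy⟩
  have hm0 : (0 : ℝ) < m := by exact_mod_cast hm
  have hone : ∀ μ ∈ latticeSet m, IsAmplitude L (fun _ => 1) 1 1 := fun _ _ => isAmplitude_one L
  have hfac : ∀ μ ∈ latticeSet m, IsAmplitude L (waveFactor γ μ) (16 * M * √m) (16 * M * √m) :=
    fun μ hμ => isAmplitude_waveFactor hγ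
      (fun t ht => (hM₁ t ht).trans ((le_max_left _ _).trans (le_max_right _ _)))
      (fun t ht => (hM₂ t ht).trans ((le_max_right _ _).trans (le_max_right _ _))) hμ
  have hfac' : ∀ μ ∈ latticeSet m,
      IsAmplitude L (waveFactor γ (-μ)) (16 * M * √m) (16 * M * √m) :=
    fun μ hμ => hfac (-μ) (neg_mem_latticeSet.2 hμ)
  have hK : (16 * M * √m) ^ 4 = c * (m : ℝ) ^ 2 := by
    have : √(m : ℝ) ^ 4 = (m : ℝ) ^ 2 := by
      rw [show √(m : ℝ) ^ 4 = (√(m : ℝ) ^ 2) ^ 2 by ring, Real.sq_sqrt hm0.le]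
    rw [mul_pow, this, hc]
  have hcc : c ≤ c ^ 2 := by nlinarith
  have hNp : 0 < (latN m : ℝ) ^ ((3 : ℝ) / 2) := Real.rpow_pos_of_pos (by exact_mod_cast hN) _
  refine ⟨?_, ?_, ?_, ?_⟩
  · refine (hmain m hm hN _ _ _ 1 1 hone hone fun t₁ t₂ => ?_).trans ?_
    · simp only [one_mul]
      exact ofReal_covFn m γ t₁ t₂
    · gcongr
      linarith
  · have h := hmain m hm hN _ _ _ _ 1 hfac hone fun t₁ t₂ => by
      simp only [one_mul]
      exact ofReal_covFn1 m d0 t₁ t₂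
    rw [inv_mul_le_iff₀ (by positivity)]
    refine h.trans ?_
    rw [hK, ← mul_div_assoc]
    refine div_le_div_of_nonneg_right ?_ hNp.le
    linarith [mul_le_mul_of_nonneg_left hcc (by positivity : 0 ≤ C * (m : ℝ) ^ 2)]
  · have h := hmain m hm hN _ _ _ 1 _ hone hfac' fun t₁ t₂ => by
      simp only [one_mul]
      exact ofReal_covFn2 m d0 t₁ t₂
    rw [inv_mul_le_iff₀ (by positivity)]
    refine h.trans ?_
    rw [hK, ← mul_div_assoc]
    refine div_le_div_of_nonneg_right ?_ hNp.le
    linarith [mul_le_mul_of_nonneg_left hcc (by positivity : 0 ≤ C * (m : ℝ) ^ 2)]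
  · have h := hmain m hm hN _ _ _ _ _ hfac hfac' fun t₁ t₂ => ofReal_covFn12 m d0 t₁ t₂
    rw [inv_mul_le_iff₀ (by positivity)]
    refine h.trans_eq ?_
    rw [hK]
    ring

end
end
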